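/- arXiv:1812.11157 — 10 statements merged into one kernel-verified Lean document; each statement's English description precedes it below -/
import Mathlib

section
/- The class of all finite two-graphs has the extension property for partial automorphisms (EPPA): for every finite two-graph A there exists a finite two-graph B containing A as an induced sub-two-graph such that every isomorphism between induced sub-two-graphs of A extends to an automorphism of B. -/
open scoped Classical in
/-- Classical indicator of a proposition. -/
noncomputable def indic (P : Prop) : ℕ := if P then 1 else 0

/-- The three-element set `{a, b, c}` (as a `Finset`), defined classically. -/
noncomputable def tri {V : Type} (a b c : V) : Finset V :=
  letI := Classical.decEq V
  {a, b, c}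

/-- A two-graph: a set of 3-element hyperedges such that every four distinct
vertices carry an even number of hyperedges. -/
def IsTwoGraph {V : Type} (T : Finset (Finset V)) : Prop :=
  (∀ t ∈ T, t.card = 3) ∧
  ∀ a b c d : V, a ≠ b → a ≠ c → a ≠ d → b ≠ c → b ≠ d → c ≠ d →
    Even (indic (tri a b c ∈ T) + indic (tri a b d ∈ T) +
      indic (tri a c d ∈ T) + indic (tri b c d ∈ T))

/-- A partial isomorphism between induced sub-two-graphs of `(V, T)`,
represented by its graph `p ⊆ V × V`: it is functional and injective, and
preserves hyperedges (and non-hyperedges) between the domain and the range. -/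
def IsPartialTGIso {V : Type} (T : Finset (Finset V)) (p : Set (V × V)) : Prop :=
  (∀ u ∈ p, ∀ v ∈ p, (u.1 = v.1 ↔ u.2 = v.2)) ∧
  (∀ u ∈ p, ∀ v ∈ p, ∀ w ∈ p, (tri u.1 v.1 w.1 ∈ T ↔ tri u.2 v.2 w.2 ∈ T))

section TriangleParity

variable {V : Type}

lemma mem_tri {x a b c : V} : x ∈ tri a b c ↔ x = a ∨ x = b ∨ x = c := by
  classical
  simp [tri]

lemma tri_swap_left (a b c : V) : tri a b c = tri b a c := by
  ext x; simp only [mem_tri]; tauto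

lemma tri_swap_right (a b c : V) : tri a b c = tri a c b := by
  ext x; simp only [mem_tri]; tauto

lemma card_tri_eq_three {a b c : V} : (tri a b c).card = 3 ↔ a ≠ b ∧ a ≠ c ∧ b ≠ c := by
  classical
  rw [Finset.card_eq_three]
  constructor
  · rintro ⟨x, y, z, hxy, hxz, hyz, h⟩
    have hx : x ∈ tri a b c := by simp [h]
    have hy : y ∈ tri a b c := by simp [h]
    have hz : z ∈ tri a b c := by simp [h]
    rw [mem_tri] at hx hy hz
    grind
  · rintro ⟨hab, hac, hbc⟩
    exact ⟨a, b, c, hab, hac, hbc, by ext x; simp [mem_tri]⟩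

open scoped Classical in
/-- The indicator modulo two of the hyperedges of `T`. -/
noncomputable def edgeParity (T : Finset (Finset V)) (a b c : V) : ZMod 2 :=
  if tri a b c ∈ T then 1 else 0

lemma edgeParity_swap_left (T : Finset (Finset V)) (a b c : V) :
    edgeParity T a b c = edgeParity T b a c := by
  rw [edgeParity, edgeParity, tri_swap_left]

lemma edgeParity_swap_right (T : Finset (Finset V)) (a b c : V) :
    edgeParity T a b c = edgeParity T a c b := by
  rw [edgeParity, edgeParity, tri_swap_right]

lemma edgeParity_eq_one_iff {T : Finset (Finset V)} {a b c : V} :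
    edgeParity T a b c = 1 ↔ tri a b c ∈ T := by
  unfold edgeParity
  split_ifs with h <;> simp [h]

lemma edgeParity_self_left {T : Finset (Finset V)} (hT : IsTwoGraph T) (a b : V) :
    edgeParity T a a b = 0 := by
  unfold edgeParity
  rw [if_neg]
  intro h
  exact (card_tri_eq_three.1 (hT.1 _ h)).1 rfl

lemma edgeParity_self_right {T : Finset (Finset V)} (hT : IsTwoGraph T) (a b : V) :
    edgeParity T a b b = 0 := by
  rw [edgeParity_swap_right, edgeParity_swap_left, edgeParity_swap_right,
    edgeParity_self_left hT]

lemma natCast_indic (T : Finset (Finset V)) (a b c : V) :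
    (indic (tri a b c ∈ T) : ZMod 2) = edgeParity T a b c := by
  unfold indic edgeParity
  split_ifs <;> simp

/-- The parity condition of a two-graph holds for arbitrary quadruples: the hyperedge
indicator is a cocycle. -/
lemma edgeParity_cocycle {T : Finset (Finset V)} (hT : IsTwoGraph T) (a b c d : V) :
    edgeParity T a b c + edgeParity T a b d + edgeParity T a c d + edgeParity T b c d = 0 := by
  have hsl := edgeParity_swap_left T
  have hsr := edgeParity_swap_right T
  have h0 := edgeParity_self_left hT
  have h0' := edgeParity_self_right hT
  have h2 : ∀ x : ZMod 2, x + x = 0 := CharTwo.add_self_eq_zero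
  by_cases hab : a = b
  · subst hab; simp [h0, h2]
  by_cases hac : a = c
  · subst hac; rw [hsr a b a, hsl b a d]; simp [h0, h2]
  by_cases had : a = d
  · subst had
    rw [hsr a b a, hsr a c a, hsr b c a, hsl b a c]; simp [h0, h2]
  by_cases hbc : b = c
  · subst hbc; simp [h0, h0', h2]
  by_cases hbd : b = d
  · subst hbd; rw [hsr b c b, hsr a c b]; simp [h0, h0', h2]
  by_cases hcd : c = d
  · subst hcd; simp [h0', h2]
  have h := hT.2 a b c d hab hac had hbc hbd hcd
  rw [← ZMod.natCast_eq_zero_iff_even] at h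
  simpa [natCast_indic] using h

/-- The coboundary of a function on pairs. -/
def coboundary (E : V → V → ZMod 2) (a b c : V) : ZMod 2 := E a b + E a c + E b c

open scoped Classical in
/-- The triples on which the coboundary of `E` does not vanish. -/
noncomputable def coboundaryTriples [Fintype V] (E : V → V → ZMod 2) : Finset (Finset V) :=
  Finset.univ.filter fun t => ∃ a b c, t = tri a b c ∧ coboundary E a b c = 1

lemma ne_of_coboundary_eq_one {E : V → V → ZMod 2} (hs : ∀ a b, E a b = E b a)
    (h0 : ∀ a, E a a = 0) {a b c : V} (h : coboundary E a b c = 1) :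
    a ≠ b ∧ a ≠ c ∧ b ≠ c := by
  have h2 : ∀ x : ZMod 2, x + x = 0 := CharTwo.add_self_eq_zero
  unfold coboundary at h
  refine ⟨?_, ?_, ?_⟩ <;> rintro rfl
  · simp [h0, h2] at h
  · simp [h0, hs b a, h2] at h
  · simp [h0, h2] at h

lemma tri_mem_coboundaryTriples [Fintype V] {E : V → V → ZMod 2} (hs : ∀ a b, E a b = E b a)
    (h0 : ∀ a, E a a = 0) {a b c : V} :
    tri a b c ∈ coboundaryTriples E ↔ coboundary E a b c = 1 := by
  classical
  simp only [coboundaryTriples, Finset.mem_filter, Finset.mem_univ, true_and]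
  refine ⟨?_, fun h => ⟨a, b, c, rfl, h⟩⟩
  rintro ⟨x, y, z, ht, h⟩
  obtain ⟨hxy, hxz, hyz⟩ := ne_of_coboundary_eq_one hs h0 h
  have hx : x ∈ tri a b c := by rw [ht, mem_tri]; simp
  have hy : y ∈ tri a b c := by rw [ht, mem_tri]; simp
  have hz : z ∈ tri a b c := by rw [ht, mem_tri]; simp
  rw [mem_tri] at hx hy hz
  unfold coboundary at h ⊢
  have h1 := hs a b
  have h2 := hs a c
  have h3 := hs b c
  grind

lemma isTwoGraph_coboundaryTriples [Fintype V] {E : V → V → ZMod 2}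
    (hs : ∀ a b, E a b = E b a) (h0 : ∀ a, E a a = 0) : IsTwoGraph (coboundaryTriples E) := by
  classical
  constructor
  · intro t ht
    simp only [coboundaryTriples, Finset.mem_filter, Finset.mem_univ, true_and] at ht
    obtain ⟨a, b, c, rfl, h⟩ := ht
    exact card_tri_eq_three.2 (ne_of_coboundary_eq_one hs h0 h)
  · intro a b c d _ _ _ _ _ _
    have key : ∀ x y z, edgeParity (coboundaryTriples E) x y z = coboundary E x y z := by
      intro x y z
      have h01 : ∀ u : ZMod 2, (if u = 1 then (1 : ZMod 2) else 0) = u := by decide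
      rw [edgeParity, ← h01 (coboundary E x y z)]
      simp only [tri_mem_coboundaryTriples hs h0]
    rw [← ZMod.natCast_eq_zero_iff_even]
    push_cast
    simp only [natCast_indic, key, coboundary]
    generalize E a b = p, E a c = q, E b c = r, E a d = s, E b d = t, E c d = u
    revert p q r s t u
    decide

end TriangleParity

section Valuations

variable {V : Type}

/-- Every function on pairs with zero diagonal arises by symmetrizing. -/
lemma exists_orientation [Finite V] (e : V → V → ZMod 2) (hs : ∀ a b, e a b = e b a)
    (h0 : ∀ a, e a a = 0) : ∃ χ : V → V → ZMod 2, ∀ x y, χ x y + χ y x = e x y := by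
  obtain ⟨n, ⟨φ⟩⟩ := Finite.exists_equiv_fin V
  refine ⟨fun x y => if φ y < φ x then e x y else 0, fun x y => ?_⟩
  rcases lt_trichotomy (φ x) (φ y) with h | h | h
  · simp [h, h.not_gt, hs x y]
  · obtain rfl := φ.injective h
    simp [h0]
  · simp [h, h.not_gt]

/-- The edge function on valuations. -/
def valuationEdge (u v : V × (V → ZMod 2)) : ZMod 2 := u.2 v.1 + v.2 u.1

lemma valuationEdge_comm (u v : V × (V → ZMod 2)) : valuationEdge u v = valuationEdge v u :=
  add_comm _ _

lemma valuationEdge_self (u : V × (V → ZMod 2)) : valuationEdge u u = 0 :=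
  CharTwo.add_self_eq_zero _

/-- The permutation of valuations that moves the base point by `π` and shifts the values
by `F`. -/
def valuationPerm (π : Equiv.Perm V) (F : V → V → ZMod 2) : Equiv.Perm (V × (V → ZMod 2)) where
  toFun u := (π u.1, fun z => u.2 (π.symm z) + F u.1 (π.symm z))
  invFun u := (π.symm u.1, fun y => u.2 (π y) + F (π.symm u.1) y)
  left_inv u := by
    ext z
    · simp
    · simp [add_assoc, CharTwo.add_self_eq_zero]
  right_inv u := by
    ext z
    · simp
    · simp [add_assoc, CharTwo.add_self_eq_zero]

/-- If `F` symmetrizes to a switching, then `valuationPerm` preserves the coboundary. -/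
lemma coboundary_valuationPerm (π : Equiv.Perm V) (F : V → V → ZMod 2) (s : V → ZMod 2)
    (hF : ∀ x y, F x y + F y x = s x + s y) (a b c : V × (V → ZMod 2)) :
    coboundary valuationEdge (valuationPerm π F a) (valuationPerm π F b) (valuationPerm π F c) =
      coboundary valuationEdge a b c := by
  have key : ∀ u v, valuationEdge (valuationPerm π F u) (valuationPerm π F v) =
      valuationEdge u v + (s u.1 + s v.1) := by
    intro u v
    rw [← hF]
    simp only [valuationEdge, valuationPerm, Equiv.coe_fn_mk, Equiv.symm_apply_apply]
    ring
  simp only [coboundary, key]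
  generalize s a.1 = p, s b.1 = q, s c.1 = r, valuationEdge a b = x, valuationEdge a c = y,
    valuationEdge b c = z
  revert p q r x y z
  decide

end Valuations

/-- A partial isomorphism extends to a permutation of the vertex set. -/
lemma IsPartialTGIso.exists_perm {V : Type} [Fintype V] {T : Finset (Finset V)}
    {p : Set (V × V)} (hp : IsPartialTGIso T p) :
    ∃ π : Equiv.Perm V, ∀ u ∈ p, π u.1 = u.2 := by
  classical
  let f : V → V := fun x => if h : ∃ y, (x, y) ∈ p then h.choose else x
  have hf : ∀ u ∈ p, f u.1 = u.2 := by
    intro u hu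
    have h : ∃ y, (u.1, y) ∈ p := ⟨u.2, hu⟩
    simp only [f, dif_pos h]
    exact (hp.1 (u.1, h.choose) h.choose_spec u hu).1 rfl
  have hinj : Set.InjOn f (Prod.fst '' p) := by
    rintro _ ⟨u, hu, rfl⟩ _ ⟨v, hv, rfl⟩ h
    rw [hf u hu, hf v hv] at h
    exact (hp.1 u hu v hv).2 h
  obtain ⟨g, hg⟩ := Set.MapsTo.exists_equiv_extend_of_card_eq (t := Finset.univ)
    (s := Prod.fst '' p) (f := f) (by simp) (fun _ _ => by simp) hinj
  refine ⟨g.trans (Equiv.subtypeUnivEquiv (by simp)), fun u hu => ?_⟩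
  rw [← hf u hu]
  exact hg _ ⟨u, hu, rfl⟩


/-- EPPA for the class of finite two-graphs: every finite two-graph `A` has a
finite two-graph `B` containing it as an induced sub-two-graph such that every
isomorphism between induced sub-two-graphs of `A` extends to an automorphism
of `B`. -/
theorem twograph_EPPA (VA : Type) [Fintype VA] (TA : Finset (Finset VA))
    (hA : IsTwoGraph TA) :
    ∃ (VB : Type) (_ : Fintype VB) (TB : Finset (Finset VB)) (i : VA ↪ VB),
      IsTwoGraph TB ∧
      (∀ a b c : VA, a ≠ b → a ≠ c → b ≠ c →
        (tri a b c ∈ TA ↔ tri (i a) (i b) (i c) ∈ TB)) ∧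
      (∀ p : Set (VA × VA), IsPartialTGIso TA p →
        ∃ g : Equiv.Perm VB,
          (∀ a b c : VB, tri (g a) (g b) (g c) ∈ TB ↔ tri a b c ∈ TB) ∧
          ∀ u ∈ p, g (i u.1) = i u.2) := by
  classical
  rcases isEmpty_or_nonempty VA with hV | ⟨⟨x₀⟩⟩
  · exact ⟨VA, inferInstance, TA, Function.Embedding.refl VA, hA, fun a => isEmptyElim a,
      fun p _ => ⟨1, fun a => isEmptyElim a, fun u _ => isEmptyElim u.1⟩⟩
  have hcocycle := edgeParity_cocycle hA
  set e : VA → VA → ZMod 2 := edgeParity TA x₀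
  have hes : ∀ a b, e a b = e b a := edgeParity_swap_right TA x₀
  have he0 : ∀ a, e a a = 0 := edgeParity_self_right hA x₀
  have hcob : ∀ a b c, edgeParity TA a b c = coboundary e a b c := fun a b c =>
    (CharTwo.add_eq_zero.1 (hcocycle x₀ a b c)).symm
  obtain ⟨χ, hχ⟩ := exists_orientation e hes he0
  have hmem {a b c : VA × (VA → ZMod 2)} :
      tri a b c ∈ coboundaryTriples valuationEdge ↔ coboundary valuationEdge a b c = 1 :=
    tri_mem_coboundaryTriples valuationEdge_comm valuationEdge_self
  obtain ⟨i, hi⟩ : ∃ i : VA ↪ VA × (VA → ZMod 2), ∀ x, i x = (x, χ x) :=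
    ⟨⟨fun x => (x, χ x), fun _ _ h => (Prod.mk.inj h).1⟩, fun _ => rfl⟩
  refine ⟨VA × (VA → ZMod 2), inferInstance, coboundaryTriples valuationEdge, i,
    isTwoGraph_coboundaryTriples valuationEdge_comm valuationEdge_self, ?_, ?_⟩
  · intro a b c _ _ _
    rw [hmem, ← edgeParity_eq_one_iff, hcob]
    simp only [coboundary, valuationEdge, hi, hχ]
  intro p hp
  obtain ⟨π, hπ⟩ := hp.exists_perm
  let D : Set VA := Prod.fst '' p
  have hiso : ∀ x ∈ D, ∀ y ∈ D, ∀ z ∈ D, coboundary e (π x) (π y) (π z) = coboundary e x y z := by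
    rintro _ ⟨u, hu, rfl⟩ _ ⟨v, hv, rfl⟩ _ ⟨w, hw, rfl⟩
    rw [hπ u hu, hπ v hv, hπ w hw, ← hcob, ← hcob]
    simp only [edgeParity, hp.2 u hu v hv w hw]
  obtain ⟨s, hs⟩ : ∃ s : VA → ZMod 2, ∀ x ∈ D, ∀ y ∈ D, e (π x) (π y) + e x y = s x + s y := by
    rcases D.eq_empty_or_nonempty with hD | ⟨x₁, hx₁⟩
    · exact ⟨0, by simp [hD]⟩
    refine ⟨fun x => e (π x) (π x₁) + e x x₁, fun x hx y hy => ?_⟩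
    have h := hiso x hx y hy x₁ hx₁
    unfold coboundary at h
    beta_reduce
    generalize e (π x) (π y) = a, e (π x) (π x₁) = b, e (π y) (π x₁) = c, e x y = a',
      e x x₁ = b', e y x₁ = c' at h ⊢
    revert a b c a' b' c'
    decide
  let G : VA → VA → ZMod 2 := fun x y => χ (π x) (π y) + χ x y
  let F : VA → VA → ZMod 2 := fun x y =>
    if x ∈ D then G x y else if y ∈ D then G y x + (s x + s y) else s x
  have hF : ∀ x y, F x y + F y x = s x + s y := by
    intro x y
    by_cases hx : x ∈ D <;> by_cases hy : y ∈ D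
    · simp only [F, G, hx, hy, if_true]
      rw [← hs x hx y hy, ← hχ, ← hχ]
      ring
    · simp only [F, hx, hy, if_true, if_false]
      rw [← add_assoc, CharTwo.add_self_eq_zero, zero_add, add_comm]
    · simp only [F, hx, hy, if_true, if_false]
      rw [add_right_comm, CharTwo.add_self_eq_zero, zero_add]
    · simp only [F, hx, hy, if_false]
  refine ⟨valuationPerm π F, fun a b c => ?_, fun u hu => ?_⟩
  · rw [hmem, hmem, coboundary_valuationPerm π F s hF]
  · have hD : u.1 ∈ D := ⟨u, hu, rfl⟩
    rw [← hπ u hu, hi, hi]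
    ext z
    · rfl
    · simp only [valuationPerm, Equiv.coe_fn_mk, F, G, hD, if_true,
        Equiv.apply_symm_apply]
      rw [add_left_comm, CharTwo.add_self_eq_zero, add_zero]
end

section
/- The class of all finite integer-valued antipodal metric spaces of diameter 3 has EPPA: for every finite antipodal integer-valued metric space A of diameter 3 there exists a finite antipodal integer-valued metric space B of diameter 3 containing A as a metric subspace such that every partial isometry of A extends to a surjective self-isometry of B. -/
/-- A (finite or infinite) integer-valued antipodal metric space of diameter 3,
given by its distance function: distances of distinct points lie in `{1,2,3}`,
the triangle inequality holds, there is no triangle with distances `2,2,3`,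
and every point has exactly one point at distance `3` from it. -/
def IsAntipodalSpace {A : Type} (d : A → A → ℕ) : Prop :=
  (∀ x : A, d x x = 0) ∧
  (∀ x y : A, d x y = d y x) ∧
  (∀ x y z : A, d x z ≤ d x y + d y z) ∧
  (∀ x y : A, x ≠ y → d x y = 1 ∨ d x y = 2 ∨ d x y = 3) ∧
  (∀ x y z : A, ¬(d x y = 2 ∧ d y z = 2 ∧ d x z = 3)) ∧
  (∀ x : A, ∃! y : A, d x y = 3)

/-- A partial isometry of `(A, d)`, represented by its graph `p ⊆ A × A`:
a functional, injective relation preserving all distances. -/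
def IsPartialIsometry {A : Type} (d : A → A → ℕ) (p : Set (A × A)) : Prop :=
  (∀ u ∈ p, ∀ v ∈ p, (u.1 = v.1 ↔ u.2 = v.2)) ∧
  (∀ u ∈ p, ∀ v ∈ p, d u.1 v.1 = d u.2 v.2)

/-- An integer-valued antipodal metric space of diameter 3, encoded by its antipodal map `σ` and
the `ZMod 2`-valued function `q` which tells the distances `0, 1` from the distances `2, 3`. -/
structure IsTwoCover {X : Type} (σ : X → X) (q : X → X → ZMod 2) : Prop where
  symm : ∀ x y, q x y = q y x
  self : ∀ x, q x x = 0
  map_left : ∀ x y, q (σ x) y = q x y + 1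
  invol : ∀ x, σ (σ x) = x

open Classical in
/-- The distance function encoded by an antipodal map `σ` and a function `q`. -/
noncomputable def coverDist {X : Type} (σ : X → X) (q : X → X → ZMod 2) (x y : X) : ℕ :=
  if x = y then 0 else if y = σ x then 3 else if q x y = 0 then 1 else 2

theorem ZMod.two_eq_zero_or_one (a : ZMod 2) : a = 0 ∨ a = 1 := by
  revert a; decide

namespace IsTwoCover

variable {X : Type} {σ : X → X} {q : X → X → ZMod 2}

theorem map_ne (h : IsTwoCover σ q) (x : X) : σ x ≠ x := by
  intro e
  have h1 := h.map_left x x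
  rw [e, h.self] at h1
  exact absurd h1 (by decide)

theorem isAntipodalSpace (h : IsTwoCover σ q) : IsAntipodalSpace (coverDist σ q) := by
  have h10 : (1 : ZMod 2) ≠ 0 := by decide
  have h11 : (1 : ZMod 2) + 1 = 0 := by decide
  have hs := h.symm
  have h0 := h.self
  have hl := h.map_left
  have hi := h.invol
  have hne := h.map_ne
  have hv := ZMod.two_eq_zero_or_one
  refine ⟨?_, ?_, ?_, ?_, ?_, ?_⟩
  · intro x
    simp [coverDist]
  · intro x y
    unfold coverDist
    grind
  · intro x y z
    have := hv (q x y)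
    have := hv (q y z)
    have := hl x y
    have := hs (σ x) y
    unfold coverDist
    grind
  · intro x y hxy
    unfold coverDist
    grind
  · intro x y z
    have := hv (q x y)
    have := hv (q y z)
    have := hl x y
    have := hs (σ x) y
    unfold coverDist
    grind
  · intro x
    refine ⟨σ x, ?_, fun y hy => ?_⟩
    · simp [coverDist, (hne x).symm]
    · simp only [coverDist] at hy
      grind

theorem coverDist_map {Y : Type} {τ : Y → Y} {q' : Y → Y → ZMod 2} {f : X → Y}
    (hf : Function.Injective f) (hσ : ∀ x, f (σ x) = τ (f x))
    (hq : ∀ x y, x ≠ y → y ≠ σ x → q' (f x) (f y) = q x y) (x y : X) :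
    coverDist τ q' (f x) (f y) = coverDist σ q x y := by
  unfold coverDist
  rw [← hσ]
  grind

end IsTwoCover

theorem IsAntipodalSpace.exists_isTwoCover {A : Type} {d : A → A → ℕ}
    (h : IsAntipodalSpace d) :
    ∃ (σ : A → A) (q : A → A → ZMod 2), IsTwoCover σ q ∧ d = coverDist σ q := by
  obtain ⟨h0, hs, ht, hv, hn, he⟩ := h
  choose σ hσ hu using he
  simp only at hσ hu
  have hi : ∀ x, σ (σ x) = x := fun x => (hu (σ x) x (by rw [hs, hσ])).symm
  have h11 : (1 : ZMod 2) + 1 = 0 := by decide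
  refine ⟨σ, fun x y => if 2 ≤ d x y then 1 else 0, ⟨?_, ?_, ?_, hi⟩, ?_⟩
  · intro x y
    simp only [hs x y]
  · intro x
    simp [h0]
  · intro x y
    have hx := hσ x
    by_cases hxy : x = y
    · subst hxy
      simp [h0, hs (σ x), hx]
    by_cases hxy' : σ x = y
    · subst hxy'
      simp [h0, hx, h11]
    have a1 := ht x y (σ x)
    have a2 := hn x y (σ x)
    have a3 := hv x y hxy
    have a4 := hv (σ x) y hxy'
    have a5 := hs y (σ x)
    have a6 : d x y ≠ 3 := fun e => hxy' (hu x y e).symm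
    have a7 : d (σ x) y ≠ 3 := fun e => hxy ((hu (σ x) y e).trans (hi x)).symm
    have a8 : d x y = 1 ∧ d (σ x) y = 2 ∨ d x y = 2 ∧ d (σ x) y = 1 := by omega
    rcases a8 with ⟨e, e'⟩ | ⟨e, e'⟩ <;> simp [e, e', h11]
  · funext x y
    have a1 := hσ x
    have a2 := hu x y
    have a6 := hv x y
    have a9 := h0 x
    simp only [coverDist]
    grind

/-- A function choosing one point from each orbit of an involution of a countable type. -/
theorem exists_orbit_representative {A : Type} [Countable A] {σ : A → A}
    (hi : ∀ x, σ (σ x) = x) :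
    ∃ r : A → A, (∀ x, r (σ x) = r x) ∧ (∀ x, r x = x ∨ r x = σ x) := by
  obtain ⟨e, he⟩ := exists_injective_nat A
  refine ⟨fun x => if e x ≤ e (σ x) then x else σ x, fun x => ?_, fun x => ?_⟩
  · have := @he x (σ x)
    simp only [hi]
    grind
  · grind

/-- The covering function on `A × (A → ZMod 2)` comparing valuation functions. -/
def valuationForm {A : Type} (a b : A × (A → ZMod 2)) : ZMod 2 := a.2 b.1 + b.2 a.1

theorem isTwoCover_valuationForm {A : Type} :
    IsTwoCover (fun a : A × (A → ZMod 2) => (a.1, a.2 + 1)) valuationForm where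
  symm a b := add_comm _ _
  self a := CharTwo.add_self_eq_zero _
  map_left a b := by simp only [valuationForm, Pi.add_apply, Pi.one_apply]; ring
  invol a := by
    ext x
    · rfl
    · simp [add_assoc, CharTwo.add_self_eq_zero]

/-- Every two-cover on a countable type admits a choice of representatives `r` and valuation
functions `χ` embedding it into the valuation space. -/
theorem IsTwoCover.exists_valuation {A : Type} [Countable A] {σ : A → A} {q : A → A → ZMod 2}
    (h : IsTwoCover σ q) :
    ∃ (r : A → A) (χ : A → A → ZMod 2), (∀ x y, r x = r y ↔ y = x ∨ y = σ x) ∧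
      (∀ x, χ (σ x) = χ x + 1) ∧
      (∀ x y, r x ≠ r y → χ x (r y) + χ y (r x) = q x y) := by
  obtain ⟨r, hr, hr'⟩ := exists_orbit_representative h.invol
  obtain ⟨e, he⟩ := exists_injective_nat A
  have hs := h.symm
  have hi := h.invol
  have h11 : (1 : ZMod 2) + 1 = 0 := by decide
  have key : ∀ x y, q x (r y) + q y (r y) = q x y := by
    intro x y
    rcases hr' y with h1 | h1 <;> rw [h1]
    · rw [h.self, add_zero]
    · rw [hs x, hs y, h.map_left, h.map_left, h.self, hs y x, zero_add, add_assoc, h11, add_zero]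
  have hrr : ∀ x, r (r x) = r x := by
    intro x
    rcases hr' x with h1 | h1 <;> simp [h1, hr]
  refine ⟨r, fun x b => if e (r x) < e (r b) then q x (r b) else q x (r x), ?_, ?_, ?_⟩
  · intro x y
    have := hr x
    have := hr y
    have := hr' x
    have := hr' y
    have := hi x
    have := hi y
    grind
  · intro x
    funext b
    simp only [hr, Pi.add_apply, Pi.one_apply, h.map_left]
    split_ifs <;> rfl
  · intro x y hxy
    have hne : e (r x) ≠ e (r y) := fun hh => hxy (he hh)
    simp only [hrr]
    rcases hne.lt_or_gt with h1 | h1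
    · rw [if_pos h1, if_neg h1.not_gt, key]
    · rw [if_neg h1.not_gt, if_pos h1, add_comm, key, hs]

/-- A permutation `π` twisted by `w` acts on the valuation space. -/
def twist {A : Type} (π : Equiv.Perm A) (w : A → A → ZMod 2) (a : A × (A → ZMod 2)) :
    A × (A → ZMod 2) :=
  (π a.1, fun k => a.2 (π.symm k) + w a.1 (π.symm k))

theorem twist_injective {A : Type} (π : Equiv.Perm A) (w : A → A → ZMod 2) :
    Function.Injective (twist π w) := by
  rintro ⟨m, χ⟩ ⟨n, ξ⟩ h
  simp only [twist, Prod.mk.injEq, π.injective.eq_iff] at h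
  obtain ⟨rfl, h⟩ := h
  refine Prod.ext rfl (funext fun k => ?_)
  simpa using congrFun h (π k)

theorem valuationForm_twist {A : Type} (π : Equiv.Perm A) {w : A → A → ZMod 2}
    (hw : ∀ m n, w m n = w n m) (a b : A × (A → ZMod 2)) :
    valuationForm (twist π w a) (twist π w b) = valuationForm a b := by
  simp only [valuationForm, twist, Equiv.symm_apply_apply]
  rw [hw b.1 a.1]
  linear_combination CharTwo.add_self_eq_zero (w a.1 b.1)

/-- A relation which is functional and injective through the maps `f` and `g` extends to a
permutation. -/
theorem exists_perm_of_relation {A ι : Type} [Finite A] {p : Set ι} {f g : ι → A}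
    (h : ∀ u ∈ p, ∀ v ∈ p, (f u = f v ↔ g u = g v)) :
    ∃ π : Equiv.Perm A, ∀ u ∈ p, π (f u) = g u := by
  classical
  have := Fintype.ofFinite A
  have hF : ∀ m, ∃ n, ∀ u ∈ p, f u = m → g u = n := by
    intro m
    by_cases hm : ∃ u ∈ p, f u = m
    · obtain ⟨u, hu, rfl⟩ := hm
      exact ⟨g u, fun v hv hvu => (h v hv u hu).1 hvu⟩
    · exact ⟨m, fun u hu e => absurd ⟨u, hu, e⟩ hm⟩
  choose F hF using hF
  obtain ⟨π, hπ⟩ := Set.MapsTo.exists_equiv_extend_of_card_eq (t := (Finset.univ : Finset A))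
    (s := f '' p) (f := F) (by simp) (by intro x _; simp) (by
      rintro _ ⟨u, hu, rfl⟩ _ ⟨v, hv, rfl⟩ e
      rw [← hF _ u hu rfl, ← hF _ v hv rfl] at e
      exact (h u hu v hv).2 e)
  refine ⟨π.trans (Equiv.subtypeUnivEquiv Finset.mem_univ), fun u hu => ?_⟩
  simpa [Equiv.subtypeUnivEquiv, ← hF _ u hu rfl] using hπ (f u) ⟨u, hu, rfl⟩

theorem IsTwoCover.exists_twist {A : Type} [Finite A] {σ : A → A} {q : A → A → ZMod 2}
    {r : A → A} {χ : A → A → ZMod 2} (h : IsTwoCover σ q)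
    (hr : ∀ x y, r x = r y ↔ y = x ∨ y = σ x) (hχ : ∀ x, χ (σ x) = χ x + 1)
    (hq : ∀ x y, r x ≠ r y → χ x (r y) + χ y (r x) = q x y)
    {p : Set (A × A)} (hp : IsPartialIsometry (coverDist σ q) p) :
    ∃ (π : Equiv.Perm A) (w : A → A → ZMod 2), (∀ m n, w m n = w n m) ∧
      ∀ u ∈ p, twist π w (r u.1, χ u.1) = (r u.2, χ u.2) := by
  classical
  obtain ⟨hp₁, hp₂⟩ := hp
  have hne := h.map_ne
  have hanti : ∀ u ∈ p, ∀ v ∈ p, (v.1 = σ u.1 ↔ v.2 = σ u.2) := by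
    intro u hu v hv
    have h1 := hp₂ u hu v hv
    have h2 := hne u.1
    have h3 := hne u.2
    unfold coverDist at h1
    grind
  have hform : ∀ u ∈ p, ∀ v ∈ p, q u.1 v.1 = q u.2 v.2 := by
    intro u hu v hv
    have h1 := hp₂ u hu v hv
    have h2 := hanti u hu v hv
    have h3 := hp₁ u hu v hv
    have h4 := h.self u.1
    have h5 := h.self u.2
    have h6 := h.map_left u.1 u.1
    have h7 := h.map_left u.2 u.2
    have h8 := h.symm u.1 v.1
    have h9 := h.symm u.2 v.2
    have h10 := ZMod.two_eq_zero_or_one (q u.1 v.1)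
    have h11 := ZMod.two_eq_zero_or_one (q u.2 v.2)
    unfold coverDist at h1
    grind
  have hrr : ∀ u ∈ p, ∀ v ∈ p, (r u.1 = r v.1 ↔ r u.2 = r v.2) := by
    intro u hu v hv
    rw [hr, hr, hanti u hu v hv, eq_comm, hp₁ u hu v hv, eq_comm]
  obtain ⟨π, hπ⟩ := exists_perm_of_relation (f := fun u : A × A => r u.1)
    (g := fun u : A × A => r u.2) hrr
  have hw : ∀ m, ∃ w : A → ZMod 2, ∀ u ∈ p, r u.1 = m → ∀ n, w n = χ u.2 (π n) + χ u.1 n := by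
    intro m
    by_cases hm : ∃ u ∈ p, r u.1 = m
    · obtain ⟨u, hu, rfl⟩ := hm
      refine ⟨fun n => χ u.2 (π n) + χ u.1 n, fun v hv hvu n => ?_⟩
      rcases (hr _ _).1 hvu.symm with e | e
      · rw [e, (hp₁ v hv u hu).1 e]
      · rw [e, (hanti u hu v hv).1 e, hχ, hχ]
        simp only [Pi.add_apply, Pi.one_apply]
        linear_combination -CharTwo.add_self_eq_zero (1 : ZMod 2)
    · exact ⟨0, fun u hu e => absurd ⟨u, hu, e⟩ hm⟩
  choose w hw using hw
  have hsymm : ∀ u ∈ p, ∀ v ∈ p, w (r u.1) (r v.1) = w (r v.1) (r u.1) := by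
    intro u hu v hv
    by_cases e : r u.1 = r v.1
    · rw [e]
    rw [hw _ u hu rfl, hw _ v hv rfl, hπ u hu, hπ v hv]
    have e' : r u.2 ≠ r v.2 := fun e' => e ((hrr u hu v hv).2 e')
    have h1 := hq _ _ e
    have h2 := hq _ _ e'
    have h3 := hform u hu v hv
    have h4 := CharTwo.add_self_eq_zero (χ v.2 (r u.2))
    have h5 := CharTwo.add_self_eq_zero (χ u.1 (r v.1))
    linear_combination h2 - h1 - h3 - h4 + h5
  let D : Set A := (fun u : A × A => r u.1) '' p
  refine ⟨π, fun m n => if m ∈ D then w m n else if n ∈ D then w n m else 0, ?_, ?_⟩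
  · intro m n
    by_cases hm : m ∈ D <;> by_cases hn : n ∈ D <;> simp only [hm, hn, if_true, if_false]
    obtain ⟨u, hu, rfl⟩ := hm
    obtain ⟨v, hv, rfl⟩ := hn
    exact hsymm u hu v hv
  · intro u hu
    have hD : r u.1 ∈ D := ⟨u, hu, rfl⟩
    refine Prod.ext (hπ u hu) (funext fun k => ?_)
    simp only [twist, hD, if_true, hw _ u hu rfl, Equiv.apply_symm_apply]
    linear_combination CharTwo.add_self_eq_zero (χ u.1 (π.symm k))

/-- EPPA for the class of finite integer-valued antipodal metric spaces of
diameter 3: every such space `A` embeds isometrically into a finite such space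
`B` in which every partial isometry of `A` extends to a surjective
self-isometry of `B`. -/
theorem antipodal_EPPA (A : Type) [Fintype A] (dA : A → A → ℕ)
    (hA : IsAntipodalSpace dA) :
    ∃ (B : Type) (_ : Fintype B) (dB : B → B → ℕ) (i : A ↪ B),
      IsAntipodalSpace dB ∧
      (∀ x y : A, dB (i x) (i y) = dA x y) ∧
      (∀ p : Set (A × A), IsPartialIsometry dA p →
        ∃ θ : B → B, Function.Bijective θ ∧
          (∀ x y : B, dB (θ x) (θ y) = dB x y) ∧
          ∀ u ∈ p, θ (i u.1) = i u.2) := by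
  classical
  obtain ⟨σ, q, h, rfl⟩ := hA.exists_isTwoCover
  obtain ⟨r, χ, hr, hχ, hq⟩ := h.exists_valuation
  have hinj : Function.Injective fun x => (r x, χ x) := by
    intro x y hxy
    simp only [Prod.mk.injEq] at hxy
    rcases (hr x y).1 hxy.1 with e | e
    · exact e.symm
    · have h1 := congrFun hxy.2 x
      rw [e, hχ] at h1
      simp at h1
  refine ⟨A × (A → ZMod 2), inferInstance, coverDist (fun a => (a.1, a.2 + 1)) valuationForm,
    ⟨fun x => (r x, χ x), hinj⟩, isTwoCover_valuationForm.isAntipodalSpace, ?_, fun p hp => ?_⟩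
  · refine IsTwoCover.coverDist_map hinj (fun x => ?_) fun x y h1 h2 => ?_
    · exact Prod.ext ((hr _ _).2 (Or.inr (h.invol x).symm)) (hχ x)
    · exact hq x y fun e => ((hr x y).1 e).elim (fun e => h1 e.symm) h2
  · obtain ⟨π, w, hw, hu⟩ := h.exists_twist hr hχ hq hp
    have hθ := twist_injective π w
    refine ⟨twist π w, Finite.injective_iff_bijective.1 hθ, ?_, hu⟩
    refine IsTwoCover.coverDist_map hθ (fun a => ?_) fun a b _ _ => valuationForm_twist π hw a b
    refine Prod.ext rfl (funext fun k => ?_)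
    simp only [twist, Pi.add_apply, Pi.one_apply]
    ring
end

section
/- The class of all finite integer-valued antipodal metric spaces of diameter 3 has coherent EPPA: for every finite antipodal integer-valued metric space A of diameter 3 there exist a finite antipodal integer-valued metric space B of diameter 3 containing A as a metric subspace and a map φ ↦ θ_φ from the set P of partial isometries of A whose domain and range are closed under taking antipodal points, to the group of surjective self-isometries of B, such that θ_φ extends φ for every φ ∈ P, and for every coherent triple (f,g,h) from P one has θ_h = θ_g ∘ θ_f. -/
/-- The domain and the range of the partial map `p` are closed under taking
antipodal points (points at distance 3). -/
def AntipodalClosed {A : Type} (d : A → A → ℕ) (p : Set (A × A)) : Prop :=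
  (∀ u ∈ p, ∀ x : A, d u.1 x = 3 → ∃ v ∈ p, v.1 = x) ∧
  (∀ u ∈ p, ∀ y : A, d u.2 y = 3 → ∃ v ∈ p, v.2 = y)

/-- `(f, g, h)` is a coherent triple of partial maps (given by their graphs):
`Dom f = Dom h`, `Range f = Dom g`, `Range g = Range h` and `h = g ∘ f`. -/
def CoherentTriple {A : Type} (f g h : Set (A × A)) : Prop :=
  Prod.fst '' f = Prod.fst '' h ∧
  Prod.snd '' f = Prod.fst '' g ∧
  Prod.snd '' g = Prod.snd '' h ∧
  ∀ x z : A, (x, z) ∈ h ↔ ∃ y : A, (x, y) ∈ f ∧ (y, z) ∈ g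

/-- Translations between points of a common orbit can be chosen as a cocycle. -/
theorem MulAction.exists_cocycle_of_orbits (G X : Type*) [Group G] [MulAction G X] :
    ∃ τ : X → X → G, (∀ x y, (∃ g : G, g • x = y) → τ x y • x = y) ∧
      ∀ x y z, τ x z = τ y z * τ x y := by
  have hc : ∀ x : X, ∃ g : G, g • x = (Quotient.mk (MulAction.orbitRel G X) x).out := fun x =>
    MulAction.orbitRel_apply.1 (Quotient.exact (Quotient.out_eq (Quotient.mk _ x)))
  choose c hc using hc
  refine ⟨fun x y => (c y)⁻¹ * c x, ?_, fun x y z => by group⟩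
  rintro x _ ⟨g, rfl⟩
  have h : (Quotient.mk (MulAction.orbitRel G X) (g • x)) = Quotient.mk _ x :=
    Quotient.sound (MulAction.orbitRel_apply.2 ⟨g, rfl⟩)
  rw [mul_smul, hc x, inv_smul_eq_iff, hc (g • x), h]

open scoped Pointwise in
/-- On a finite type, the injections between subsets have an extension to permutations
that off the domain agrees with a cocycle `τ` depending only on domain and range. -/
theorem Equiv.Perm.exists_coherent_extension (M : Type*) [Fintype M] :
    ∃ τ : Set M → Set M → Equiv.Perm M, (∀ S T U, τ S U = τ T U * τ S T) ∧
      ∀ (S : Set M) (φ : M → M), S.InjOn φ → ∃ π : Equiv.Perm M, (∀ m ∈ S, π m = φ m) ∧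
        ∀ m ∉ S, π m = τ S (φ '' S) m ∧ π m ∉ φ '' S := by
  classical
  obtain ⟨τ, hτ, hcomp⟩ := MulAction.exists_cocycle_of_orbits (Equiv.Perm M) (Set M)
  refine ⟨τ, hcomp, fun S φ hφ => ?_⟩
  have hext : ∃ σ : Equiv.Perm M, σ • S = φ '' S := by
    obtain ⟨g, hg⟩ := Set.MapsTo.exists_equiv_extend_of_card_eq (t := Finset.univ)
      (by simp) (fun x _ => by simp : Set.MapsTo φ S _) hφ
    refine ⟨g.trans (Equiv.subtypeUnivEquiv (by simp)), ?_⟩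
    ext y
    simp only [Set.mem_smul_set, Set.mem_image, Equiv.Perm.smul_def]
    refine exists_congr fun x => and_congr_right fun hx => ?_
    rw [← hg x hx]
    rfl
  have hST := hτ _ _ hext
  have hoff : ∀ m ∉ S, τ S (φ '' S) m ∉ φ '' S := fun m hm h => by
    have h' : τ S (φ '' S) • m ∈ τ S (φ '' S) • S := by rwa [hST]
    exact hm (Set.smul_mem_smul_set_iff.1 h')
  let f : M → M := fun m => if m ∈ S then φ m else τ S (φ '' S) m
  have hf : Function.Injective f := by
    intro a b hab
    by_cases ha : a ∈ S <;> by_cases hb : b ∈ S <;> simp only [f, ha, hb, if_true, if_false] at hab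
    · exact hφ ha hb hab
    · exact (hoff b hb (hab ▸ ⟨a, ha, rfl⟩)).elim
    · exact (hoff a ha (hab ▸ ⟨b, hb, rfl⟩)).elim
    · exact (τ S _).injective hab
  refine ⟨Equiv.ofBijective f (Finite.injective_iff_bijective.1 hf), fun m hm => by simp [f, hm],
    fun m hm => ?_⟩
  simpa [f, hm] using hoff m hm

/-- The points of an antipodal space, up to antipodality, index the factor `M`; each point is
coded by its class and a `Bool`-valued function on the classes, which determine distances. -/
theorem IsAntipodalSpace.exists_code {A : Type} [Fintype A] {d : A → A → ℕ}
    (hd : IsAntipodalSpace d) :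
    ∃ (M : Type) (_ : Fintype M) (e : A → M) (χ : A → M → Bool),
      (∀ x y, e x = e y → x ≠ y → d x y = 3 ∧ χ y = fun m => !χ x m) ∧
      ∀ x y, e x ≠ e y → d x y = if χ x (e y) = χ y (e x) then 1 else 2 := by
  classical
  obtain ⟨h0, hs, ht, h123, h223, h3⟩ := hd
  choose a ha hau using h3
  simp only at hau
  have haa : ∀ x, a (a x) = x := fun x => (hau (a x) x (by rw [hs]; exact ha x)).symm
  have hne : ∀ x, a x ≠ x := fun x h => by have := ha x; rw [h, h0] at this; omega
  have hflip : ∀ x y, y ≠ x → y ≠ a x →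
      (d x y = 1 ∧ d x (a y) = 2) ∨ (d x y = 2 ∧ d x (a y) = 1) := by
    intro x y h1 h2
    have h4 : a y ≠ x := fun h => h2 (by rw [← h, haa])
    have h5 := h123 x y h1.symm
    have h6 := h123 x (a y) h4.symm
    have h7 : d x y ≠ 3 := fun h => h2 (hau x y h)
    have h8 : d x (a y) ≠ 3 := fun h => h1 (by rw [← haa y, hau x _ h, haa])
    have h9 := ha y
    have h10 := ht y x (a y)
    have h11 := h223 y x (a y)
    rw [hs y x] at h10 h11
    omega
  let n : A → ℕ := fun x => Fintype.equivFin A x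
  have hn : ∀ {x y}, n x = n y → x = y := fun h =>
    (Fintype.equivFin A).injective (Fin.ext h)
  let e : A → {x : A // n x < n (a x)} := fun x =>
    if h : n x < n (a x) then ⟨x, h⟩ else
      ⟨a x, by
        have : n (a x) ≠ n x := fun h' => hne x (hn h')
        rw [haa]; omega⟩
  have he : ∀ x, (e x : A) = if n x < n (a x) then x else a x := fun x => by
    by_cases h : n x < n (a x) <;> simp [e, h]
  have hee : ∀ x y, e x = e y → x ≠ y → y = a x := fun x y h hxy => by
    have := congrArg Subtype.val h
    rw [he, he] at this
    grind
  let χ : A → {x : A // n x < n (a x)} → Bool := fun x m =>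
    if n (e x) < n m then decide (d x m = 2) else decide ((e x : A) ≠ x)
  have heq : ∀ x, (e x : A) = x ∨ (e x : A) = a x := fun x => by
    rw [he]; split <;> simp
  have hea : ∀ x, e (a x) = e x := fun x => by
    apply Subtype.ext
    rw [he, he, haa]
    have : n (a x) ≠ n x := fun h' => hne x (hn h')
    split_ifs <;> first | rfl | omega
  have hlt : ∀ x y, n (e x) < n (e y) → d x y = if χ x (e y) = χ y (e x) then 1 else 2 := by
    intro x y h
    have h1 : χ x (e y) = decide (d x (e y) = 2) := if_pos h
    have h2 : χ y (e x) = decide ((e y : A) ≠ y) := if_neg (by omega)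
    have h3 : y ≠ x := by rintro rfl; omega
    have h4 : y ≠ a x := by rintro rfl; rw [hea] at h; omega
    rw [h1, h2]
    rcases heq y with hy | hy <;> rw [hy] <;> rcases hflip x y h3 h4 with hf | hf <;>
      simp [hf.1, hf.2, hne]
  have hem : ∀ m : {x : A // n x < n (a x)}, e m = m := fun m =>
    Subtype.ext (by rw [he, if_pos m.2])
  refine ⟨_, inferInstance, e, χ, ?_, ?_⟩
  · intro x y hxy hne'
    obtain rfl := hee x y hxy hne'
    refine ⟨ha x, funext fun m => ?_⟩
    simp only [χ, hea]
    split_ifs with h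
    · have h3 : (m : A) ≠ x := by
        intro h'
        rw [← h', hem] at h
        omega
      have h4 : (m : A) ≠ a x := by
        intro h'
        rw [← hea, ← h', hem] at h
        omega
      have h5 : (m : A) ≠ a (a x) := by rwa [haa]
      have h6 := hflip m x h3.symm (fun h => h4 (by rw [h, haa]))
      rw [hs _ x, hs _ (a x)] at h6
      rcases h6 with h6 | h6 <;> simp [h6.1, h6.2]
    · rcases heq x with hx | hx <;> rw [hx] <;> simp [hne, (hne x).symm]
  · intro x y hxy
    rcases lt_trichotomy (n (e x)) (n (e y)) with h | h | h
    · exact hlt x y h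
    · exact (hxy (Subtype.ext (hn h))).elim
    · rw [hs, hlt y x h]
      simp only [eq_comm (a := χ y (e x))]

/-- The distance on `M × (M → Bool)`. -/
def codeDist {M : Type} [DecidableEq M] [Fintype M] (x y : M × (M → Bool)) : ℕ :=
  if x = y then 0
  else if x.1 = y.1 ∧ y.2 = fun m => !x.2 m then 3
  else if x.2 y.1 = y.2 x.1 then 1 else 2

theorem codeDist_isAntipodalSpace (M : Type) [DecidableEq M] [Fintype M] :
    IsAntipodalSpace (codeDist (M := M)) := by
  have hself : ∀ x : M × (M → Bool), codeDist x x = 0 := fun x => by simp [codeDist]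
  have h3 : ∀ x y : M × (M → Bool), codeDist x y = 3 ↔ y = (x.1, fun m => !x.2 m) := by
    rintro ⟨m, χ⟩ ⟨k, ψ⟩
    unfold codeDist
    constructor
    · intro h
      split_ifs at h with h1 h2
      · exact Prod.ext h2.1.symm h2.2
      all_goals omega
    · intro h
      obtain ⟨rfl, rfl⟩ := Prod.mk.inj h
      rw [if_neg, if_pos ⟨rfl, rfl⟩]
      intro h
      have := congrFun (Prod.mk.inj h).2 k
      simp at this
  have hsymm : ∀ x y : M × (M → Bool), codeDist x y = codeDist y x := by
    intro x y
    have hn : (x.1 = y.1 ∧ y.2 = fun m => !x.2 m) ↔ (y.1 = x.1 ∧ x.2 = fun m => !y.2 m) := by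
      constructor <;> rintro ⟨h1, h2⟩ <;> exact ⟨h1.symm, by simp [h2]⟩
    simp only [codeDist, hn, eq_comm (a := x) (b := y), eq_comm (a := x.2 y.1)]
  have hval : ∀ x y : M × (M → Bool), x ≠ y → 1 ≤ codeDist x y ∧ codeDist x y ≤ 3 := by
    intro x y h
    unfold codeDist
    rw [if_neg h]
    split_ifs <;> simp
  have hflip : ∀ x y z : M × (M → Bool), codeDist x z = 3 → x ≠ y → y ≠ z →
      codeDist x y + codeDist y z = 3 := by
    intro x y z hxz hxy hyz
    rw [hsymm y z]
    have hxy3 : codeDist x y ≠ 3 := fun h => hyz (((h3 _ _).1 h).trans ((h3 _ _).1 hxz).symm)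
    have hzy3 : codeDist z y ≠ 3 := fun h =>
      hxy (((h3 _ _).1 ((hsymm _ _).trans hxz)).trans ((h3 _ _).1 h).symm)
    have hz := (h3 _ _).1 hxz
    have hz1 : z.1 = x.1 := by rw [hz]
    have hz2 : z.2 y.1 = !x.2 y.1 := by rw [hz]
    unfold codeDist at *
    rw [if_neg hxy] at *
    rw [if_neg hyz.symm] at *
    rw [hz1, hz2] at *
    grind
  refine ⟨hself, hsymm, fun x y z => ?_, fun x y h => ?_, fun x y z h => ?_, fun x => ?_⟩
  · by_cases hxy : x = y
    · subst hxy; omega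
    by_cases hyz : y = z
    · subst hyz; omega
    have h1 := hval x y hxy
    have h2 := hval y z hyz
    by_cases hxz : codeDist x z = 3
    · rw [hflip x y z hxz hxy hyz, hxz]
    · by_cases h : x = z
      · subst h; rw [hself]; omega
      · have := hval x z h
        omega
  · have := hval x y h
    omega
  · obtain ⟨h1, h2, h4⟩ := h
    have := hflip x y z h4 (by rintro rfl; rw [hself] at h1; omega)
      (by rintro rfl; rw [hself] at h2; omega)
    omega
  · simp only [h3]
    exact existsUnique_eq

/-- The map on codes induced by a permutation of `M` and a family of coordinate flips. -/
def codeAct {M : Type} (π : Equiv.Perm M) (F : M → M → Bool) (x : M × (M → Bool)) :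
    M × (M → Bool) :=
  (π x.1, fun k => xor (x.2 (π.symm k)) (F x.1 (π.symm k)))

theorem codeAct_injective {M : Type} (π : Equiv.Perm M) (F : M → M → Bool) :
    Function.Injective (codeAct π F) := by
  rintro ⟨m, χ⟩ ⟨k, ψ⟩ h
  obtain ⟨h1, h2⟩ := Prod.mk.inj h
  obtain rfl := π.injective h1
  refine Prod.ext rfl (funext fun j => ?_)
  have := congrFun h2 (π j)
  simpa using this

theorem codeDist_codeAct {M : Type} [DecidableEq M] [Fintype M] (π : Equiv.Perm M)
    {F : M → M → Bool} (hF : ∀ m k, F m k = F k m) (x y : M × (M → Bool)) :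
    codeDist (codeAct π F x) (codeAct π F y) = codeDist x y := by
  have h2 : ((codeAct π F x).1 = (codeAct π F y).1 ∧
      (codeAct π F y).2 = fun m => !(codeAct π F x).2 m) ↔
      (x.1 = y.1 ∧ y.2 = fun m => !x.2 m) := by
    obtain ⟨m, χ⟩ := x
    obtain ⟨k, ψ⟩ := y
    simp only [codeAct, π.injective.eq_iff]
    refine and_congr_right fun h => ?_
    subst h
    rw [funext_iff, funext_iff, π.symm.forall_congr_left]
    refine forall_congr' fun j => ?_
    simp only [Equiv.symm_symm, Equiv.symm_apply_apply]
    cases χ j <;> cases ψ j <;> cases F m j <;> simp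
  have h3 : ((codeAct π F x).2 (codeAct π F y).1 = (codeAct π F y).2 (codeAct π F x).1) ↔
      x.2 y.1 = y.2 x.1 := by
    simp only [codeAct, Equiv.symm_apply_apply, hF y.1 x.1]
    cases x.2 y.1 <;> cases y.2 x.1 <;> cases F x.1 y.1 <;> simp
  simp only [codeDist, h2, h3, (codeAct_injective π F).eq_iff]


/-- Coherent EPPA for the class of finite integer-valued antipodal metric
spaces of diameter 3: there are an extension `B` of `A` and an assignment
`Θ` of surjective self-isometries of `B` to the partial isometries of `A`
with antipodally closed domain and range, extending them, such that coherent
triples are sent to composing triples. -/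
theorem antipodal_coherent_EPPA (A : Type) [Fintype A] (dA : A → A → ℕ)
    (hA : IsAntipodalSpace dA) :
    ∃ (B : Type) (_ : Fintype B) (dB : B → B → ℕ) (i : A ↪ B)
      (Θ : Set (A × A) → (B → B)),
      IsAntipodalSpace dB ∧
      (∀ x y : A, dB (i x) (i y) = dA x y) ∧
      (∀ p : Set (A × A), IsPartialIsometry dA p → AntipodalClosed dA p →
        Function.Bijective (Θ p) ∧
        (∀ x y : B, dB (Θ p x) (Θ p y) = dB x y) ∧
        ∀ u ∈ p, Θ p (i u.1) = i u.2) ∧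
      (∀ f g h : Set (A × A),
        IsPartialIsometry dA f → AntipodalClosed dA f →
        IsPartialIsometry dA g → AntipodalClosed dA g →
        IsPartialIsometry dA h → AntipodalClosed dA h →
        CoherentTriple f g h → Θ h = Θ g ∘ Θ f) := by
  classical
  obtain ⟨M, _, e, χ, hsame, hdiff⟩ := hA.exists_code
  obtain ⟨τ, hτ, hext⟩ := Equiv.Perm.exists_coherent_extension M
  have h0 := hA.1
  have hdiff3 : ∀ x y, e x ≠ e y → dA x y ≠ 0 ∧ dA x y ≠ 3 := fun x y h => by
    rw [hdiff x y h]; split_ifs <;> simp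
  have hclass : ∀ x y, e x = e y ↔ dA x y = 0 ∨ dA x y = 3 := fun x y => by
    constructor
    · intro h
      by_cases hxy : x = y
      · subst hxy; exact Or.inl (h0 x)
      · exact Or.inr (hsame x y h hxy).1
    · intro h
      by_contra hne
      have := hdiff3 x y hne
      omega
  let S : Set (A × A) → Set M := fun p => e '' (Prod.fst '' p)
  let T : Set (A × A) → Set M := fun p => e '' (Prod.snd '' p)
  have key : ∀ p : Set (A × A), ∃ (π : Equiv.Perm M) (F : M → M → Bool),
      IsPartialIsometry dA p →
      (∀ u ∈ p, π (e u.1) = e u.2) ∧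
      (∀ m ∉ S p, π m = τ (S p) (T p) m ∧ π m ∉ T p) ∧
      (∀ u ∈ p, ∀ k, F (e u.1) k = xor (χ u.1 k) (χ u.2 (π k))) ∧
      (∀ m k, F m k = F k m) ∧
      (∀ m ∉ S p, ∀ k ∉ S p, F m k = false) := by
    intro p
    by_cases hp : IsPartialIsometry dA p
    swap
    · exact ⟨1, fun _ _ => false, fun h => (hp h).elim⟩
    rcases isEmpty_or_nonempty A with hA' | hA'
    · exact ⟨τ (S p) (T p), fun _ _ => false, fun _ => ⟨fun u => isEmptyElim u.1,
        fun m _ => ⟨rfl, by rintro ⟨x, -⟩; exact isEmptyElim x⟩, fun u => isEmptyElim u.1,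
        fun _ _ => rfl, fun _ _ _ _ => rfl⟩⟩
    have hpe : ∀ u ∈ p, ∀ v ∈ p, (e u.1 = e v.1 ↔ e u.2 = e v.2) := fun u hu v hv => by
      rw [hclass, hclass, hp.2 u hu v hv]
    have hS : ∀ m ∈ S p, ∃ u ∈ p, e u.1 = m := by
      rintro _ ⟨_, ⟨u, hu, rfl⟩, rfl⟩
      exact ⟨u, hu, rfl⟩
    have hmem : ∀ u ∈ p, e u.1 ∈ S p := fun u hu => ⟨_, ⟨u, hu, rfl⟩, rfl⟩
    choose! r hrp hr using hS
    have hφ : ∀ u ∈ p, e (r (e u.1)).2 = e u.2 := fun u hu =>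
      (hpe _ (hrp _ (hmem u hu)) u hu).1 (hr _ (hmem u hu))
    obtain ⟨π, hπ1, hπ2⟩ := hext (S p) (fun m => e (r m).2) (fun m hm k hk h => by
      rw [← hr m hm, ← hr k hk]
      exact (hpe _ (hrp m hm) _ (hrp k hk)).2 h)
    have hT : (fun m => e (r m).2) '' S p = T p := by
      ext m
      constructor
      · rintro ⟨k, hk, rfl⟩
        exact ⟨_, ⟨r k, hrp k hk, rfl⟩, rfl⟩
      · rintro ⟨_, ⟨u, hu, rfl⟩, rfl⟩
        exact ⟨_, hmem u hu, hφ u hu⟩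
    rw [hT] at hπ2
    have hπ : ∀ u ∈ p, π (e u.1) = e u.2 := fun u hu => by
      rw [hπ1 _ (hmem u hu)]
      exact hφ u hu
    let G : A × A → M → Bool := fun u k => xor (χ u.1 k) (χ u.2 (π k))
    have hG : ∀ u ∈ p, ∀ v ∈ p, e u.1 = e v.1 → G u = G v := by
      intro u hu v hv huv
      by_cases h1 : u.1 = v.1
      · have h2 := (hp.1 u hu v hv).1 h1
        simp only [G, h1, h2]
      · have h2 := fun h => h1 ((hp.1 u hu v hv).2 h)
        have h3 := (hsame _ _ huv h1).2
        have h4 := (hsame _ _ ((hpe u hu v hv).1 huv) h2).2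
        funext k
        simp only [G, h3, h4]
        simp
    have hGsymm : ∀ u ∈ p, ∀ v ∈ p, G u (e v.1) = G v (e u.1) := by
      intro u hu v hv
      by_cases huv : e u.1 = e v.1
      · rw [hG u hu v hv huv, huv]
      · have huv2 : e u.2 ≠ e v.2 := fun h => huv ((hpe u hu v hv).2 h)
        have h := hp.2 u hu v hv
        rw [hdiff _ _ huv, hdiff _ _ huv2] at h
        simp only [G, hπ u hu, hπ v hv]
        revert h
        cases χ u.1 (e v.1) <;> cases χ v.1 (e u.1) <;> cases χ u.2 (e v.2) <;>
          cases χ v.2 (e u.2) <;> simp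
    refine ⟨π, fun m k => if m ∈ S p then G (r m) k else if k ∈ S p then G (r k) m else false,
      fun _ => ⟨hπ, hπ2, ?_, ?_, ?_⟩⟩
    · intro u hu k
      beta_reduce
      rw [if_pos (hmem u hu), hG _ (hrp _ (hmem u hu)) u hu (hr _ (hmem u hu))]
    · intro m k
      by_cases hm : m ∈ S p <;> by_cases hk : k ∈ S p <;> simp only [hm, hk, if_true, if_false]
      have := hGsymm _ (hrp m hm) _ (hrp k hk)
      rwa [hr m hm, hr k hk] at this
    · intro m hm k hk
      simp only [hm, hk, if_false]
  choose π F hπF using key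
  refine ⟨M × (M → Bool), inferInstance, codeDist, ⟨fun x => (e x, χ x), fun x y h => ?_⟩,
    fun p => codeAct (π p) (F p), codeDist_isAntipodalSpace M, fun x y => ?_, fun p hp _ => ?_, ?_⟩
  · obtain ⟨h1, h2⟩ := Prod.mk.inj h
    by_contra hne
    have := congrFun ((hsame x y h1 hne).2.symm.trans h2.symm) (e x)
    simp at this
  · by_cases hxy : x = y
    · subst hxy; simp [codeDist, h0]
    change codeDist (e x, χ x) (e y, χ y) = _
    by_cases hexy : e x = e y
    · obtain ⟨h1, h2⟩ := hsame x y hexy hxy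
      rw [h1, codeDist, if_neg, if_pos ⟨hexy, h2⟩]
      intro h
      have := congrFun (h2.symm.trans (Prod.mk.inj h).2.symm) (e x)
      simp at this
    · rw [hdiff x y hexy, codeDist, if_neg (fun h => hexy (Prod.mk.inj h).1),
        if_neg (fun h => hexy h.1)]
  · obtain ⟨h1, -, h3, h4, -⟩ := hπF p hp
    refine ⟨Finite.injective_iff_bijective.1 (codeAct_injective _ _), codeDist_codeAct _ h4,
      fun u hu => Prod.ext (h1 u hu) (funext fun k => ?_)⟩
    change xor (χ u.1 _) (F p (e u.1) _) = χ u.2 k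
    rw [h3 u hu]
    simp
  · rintro f g h hf - hg - hh - ⟨hdom, hmid, hran, hcomp⟩
    obtain ⟨f1, f2, f3, f4, f5⟩ := hπF f hf
    obtain ⟨g1, g2, g3, g4, g5⟩ := hπF g hg
    obtain ⟨h1, h2, h3, h4, h5⟩ := hπF h hh
    have hSfh : S f = S h := congrArg (e '' ·) hdom
    have hTSfg : T f = S g := congrArg (e '' ·) hmid
    have hTgh : T g = T h := congrArg (e '' ·) hran
    have hS : ∀ m ∈ S h, ∃ x y z, (x, y) ∈ f ∧ (y, z) ∈ g ∧ (x, z) ∈ h ∧ e x = m := by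
      rintro _ ⟨_, ⟨⟨x, z⟩, hu, rfl⟩, rfl⟩
      obtain ⟨y, hy1, hy2⟩ := (hcomp x z).1 hu
      exact ⟨x, y, z, hy1, hy2, hu, rfl⟩
    have hπ : ∀ m, π h m = π g (π f m) := by
      intro m
      by_cases hm : m ∈ S h
      · obtain ⟨x, y, z, hxy, hyz, hxz, rfl⟩ := hS m hm
        rw [f1 _ hxy, g1 _ hyz, h1 _ hxz]
      · have hmf := f2 m (hSfh ▸ hm)
        have hmg := g2 (π f m) (hTSfg ▸ hmf.2)
        rw [hmg.1, hmf.1, (h2 m hm).1, hτ _ (S g), ← hTSfg, ← hTgh, hSfh]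
        rfl
    have hFS : ∀ m ∈ S h, ∀ k, F h m k = xor (F f m k) (F g (π f m) (π f k)) := by
      intro m hm k
      obtain ⟨x, y, z, hxy, hyz, hxz, rfl⟩ := hS m hm
      rw [f3 _ hxy, h3 _ hxz, f1 _ hxy, g3 _ hyz, hπ]
      simp
    have hF : ∀ m k, F h m k = xor (F f m k) (F g (π f m) (π f k)) := by
      intro m k
      by_cases hm : m ∈ S h
      · exact hFS m hm k
      by_cases hk : k ∈ S h
      · rw [h4, f4, g4]
        exact hFS k hk m
      · rw [h5 m hm k hk, f5 m (hSfh ▸ hm) k (hSfh ▸ hk),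
          g5 _ (hTSfg ▸ (f2 m (hSfh ▸ hm)).2) _ (hTSfg ▸ (f2 k (hSfh ▸ hk)).2)]
        rfl
    have hπ' : π h = (π f).trans (π g) := Equiv.ext hπ
    funext x
    refine Prod.ext (hπ x.1) (funext fun k => ?_)
    simp [codeAct, hF, hπ']
end

section
/- For every finite set M, the structure B(M) is a finite antipodal integer-valued metric space of diameter 3: the function d is a metric on B(M), the distance between any two distinct points lies in {1,2,3}, no three points have pairwise distances 2,2,3, and every point (e,χ) has exactly one point at distance 3, namely (e,1−χ). -/
/-- The distance function of the space `B(M)`: points are pairs `(e, χ)` with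
`e ∈ M` and `χ : M → Bool` a valuation function; `d((e,χ),(e,1-χ)) = 3`,
and distinct non-antipodal points `(e,χ)`, `(f,χ')` are at distance `1` when
`χ(f) = χ'(e)` and at distance `2` otherwise. -/
def dBM {M : Type} [Fintype M] [DecidableEq M] :
    (M × (M → Bool)) → (M × (M → Bool)) → ℕ := fun u v =>
  if u = v then 0
  else if u.1 = v.1 ∧ v.2 = (fun x => !u.2 x) then 3
  else if u.2 v.1 = v.2 u.1 then 1 else 2

section
variable {M : Type}

/-- The antipode `(e, 1-χ)` of a point `(e, χ)`. -/
def antipodeBM (u : M × (M → Bool)) : M × (M → Bool) := (u.1, fun x => !u.2 x)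

theorem antipodeBM_antipodeBM (u : M × (M → Bool)) : antipodeBM (antipodeBM u) = u := by
  simp [antipodeBM]

theorem antipodeBM_ne (u : M × (M → Bool)) : antipodeBM u ≠ u := fun h => by
  simpa [antipodeBM] using congrFun (congrArg Prod.snd h) u.1

variable [Fintype M] [DecidableEq M]

theorem dBM_eq (u v : M × (M → Bool)) :
    dBM u v = if u = v then 0 else if v = antipodeBM u then 3
      else if u.2 v.1 = v.2 u.1 then 1 else 2 := by
  simp only [dBM, antipodeBM, Prod.ext_iff (x := v), eq_comm (a := u.1)]

theorem dBM_eq_zero_iff {u v : M × (M → Bool)} : dBM u v = 0 ↔ u = v := by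
  rw [dBM_eq]
  split_ifs <;> simp_all

theorem dBM_eq_three_iff {u v : M × (M → Bool)} : dBM u v = 3 ↔ v = antipodeBM u := by
  rw [dBM_eq]
  split_ifs with h <;> simp_all [(antipodeBM_ne v).symm]

theorem dBM_comm (u v : M × (M → Bool)) : dBM u v = dBM v u := by
  have h : v = antipodeBM u ↔ u = antipodeBM v :=
    ⟨fun h => by rw [h, antipodeBM_antipodeBM], fun h => by rw [h, antipodeBM_antipodeBM]⟩
  simp only [dBM_eq, h, eq_comm (a := u), eq_comm (a := u.2 v.1)]

theorem dBM_le_three (u v : M × (M → Bool)) : dBM u v ≤ 3 := by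
  rw [dBM_eq]
  split_ifs <;> simp

/-- Every point lies on a geodesic between any two antipodal points. -/
theorem dBM_add_dBM_antipodeBM (u v : M × (M → Bool)) :
    dBM u v + dBM v (antipodeBM u) = 3 := by
  rcases eq_or_ne u v with rfl | h
  · rw [dBM_eq_zero_iff.2 rfl, dBM_eq_three_iff.2 rfl]
  rcases eq_or_ne v (antipodeBM u) with rfl | h'
  · rw [dBM_eq_zero_iff.2 rfl, dBM_eq_three_iff.2 rfl]
  have h'' : antipodeBM u ≠ antipodeBM v := fun e => h <| by
    rw [← antipodeBM_antipodeBM u, e, antipodeBM_antipodeBM]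
  rw [dBM_eq u v, dBM_eq v, if_neg h, if_neg h', if_neg h', if_neg h'']
  have h₃ : ∀ a b : Bool, (if a = b then 1 else 2) + (if b = !a then 1 else 2) = 3 := by decide
  exact h₃ _ _

theorem dBM_triangle (u v w : M × (M → Bool)) : dBM u w ≤ dBM u v + dBM v w := by
  by_cases h : dBM u w = 3
  · rw [dBM_eq_three_iff.1 h, dBM_add_dBM_antipodeBM]
    exact dBM_le_three _ _
  · rcases eq_or_ne u v with rfl | huv
    · simp
    rcases eq_or_ne v w with rfl | hvw
    · simp
    have := dBM_le_three u w
    have := mt dBM_eq_zero_iff.1 huv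
    have := mt dBM_eq_zero_iff.1 hvw
    omega

end

/-- For every finite set `M`, the structure `B(M)` is a finite antipodal
integer-valued metric space of diameter 3, in which the unique point at
distance 3 from `(e, χ)` is `(e, 1-χ)`. -/
theorem BM_is_antipodal (M : Type) [Fintype M] [DecidableEq M] :
    IsAntipodalSpace (dBM (M := M)) ∧
    ∀ u : M × (M → Bool),
      dBM u (u.1, fun x => !u.2 x) = 3 ∧
      ∀ v : M × (M → Bool), dBM u v = 3 → v = (u.1, fun x => !u.2 x) := by
  refine ⟨⟨fun x => dBM_eq_zero_iff.2 rfl, dBM_comm, dBM_triangle, fun x y h => ?_, ?_,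
    fun x => ⟨antipodeBM x, dBM_eq_three_iff.2 rfl, fun y => dBM_eq_three_iff.1⟩⟩,
    fun u => ⟨dBM_eq_three_iff.2 rfl, fun v => dBM_eq_three_iff.1⟩⟩
  · have := dBM_le_three x y
    have := mt dBM_eq_zero_iff.1 h
    omega
  · rintro x y z ⟨hxy, hyz, hxz⟩
    have := dBM_add_dBM_antipodeBM x y
    rw [← dBM_eq_three_iff.1 hxz] at this
    omega
end

section
/- Let A be a finite antipodal integer-valued metric space of diameter 3 and let p: A → {0,1} be a function with p(x) ≠ p(x') whenever d(x,x') = 3. Then there exist a finite antipodal integer-valued metric space B of diameter 3 containing A as a metric subspace and a function p̂: B → {0,1} extending p, such that every partial isometry φ of A extends to a surjective self-isometry θ of B, and moreover if φ satisfies p(φ(x)) = p(x) for all x in its domain, then θ can be chosen so that p̂(θ(y)) = p̂(y) for all y ∈ B. -/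
namespace AntipodalEPPA

/-- The parity of a vertex `(e, χ)` relative to `(f, ψ)` in the valuation space. -/
def parity {M : Type} (x y : M × (M → Bool)) : Bool := xor (x.2 y.1) (y.2 x.1)

/-- The antipode of a vertex of the valuation space. -/
def antipode {M : Type} (x : M × (M → Bool)) : M × (M → Bool) := (x.1, fun f => !x.2 f)

open Classical in
/-- The distance of the valuation space on `M × (M → Bool)`. -/
noncomputable def valDist {M : Type} (x y : M × (M → Bool)) : ℕ :=
  if x = y then 0 else if y = antipode x then 3 else if parity x y then 2 else 1

section ValuationSpace

variable {M : Type}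

theorem parity_self (x : M × (M → Bool)) : parity x x = false := by
  simp [parity]

theorem parity_comm (x y : M × (M → Bool)) : parity x y = parity y x := by
  simp [parity, Bool.xor_comm]

theorem parity_antipode (x y : M × (M → Bool)) : parity x (antipode y) = !parity x y := by
  simp [parity, antipode]

theorem antipode_antipode (x : M × (M → Bool)) : antipode (antipode x) = x := by
  simp [antipode]

theorem antipode_ne (x : M × (M → Bool)) : antipode x ≠ x := by
  intro h
  have := congrFun (congrArg Prod.snd h) x.1
  simp [antipode] at this

theorem eq_antipode_comm {x y : M × (M → Bool)} : x = antipode y ↔ y = antipode x := by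
  constructor <;> rintro rfl <;> rw [antipode_antipode]

theorem isAntipodalSpace_valDist : IsAntipodalSpace (valDist (M := M)) := by
  refine ⟨?_, ?_, ?_, ?_, ?_, ?_⟩
  · intro x
    simp [valDist]
  · intro x y
    have h := parity_comm x y
    have ha := eq_antipode_comm (x := x) (y := y)
    unfold valDist
    grind
  · intro x y z
    have hy := parity_antipode y x
    have h := parity_comm x y
    unfold valDist
    grind
  · intro x y hxy
    unfold valDist
    grind
  · intro x y z
    have hy := parity_antipode y x
    have h := parity_comm x y
    have ha := antipode_ne x
    unfold valDist
    grind
  · intro x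
    refine ⟨antipode x, ?_, ?_⟩
    · simp [valDist, (antipode_ne x).symm]
    · intro y
      simp only [valDist]
      grind

end ValuationSpace

/-- The self-map of the valuation space induced by a permutation of `M` and a flip function. -/
def twist {M : Type} (π : Equiv.Perm M) (F : M → M → Bool) (x : M × (M → Bool)) :
    M × (M → Bool) :=
  (π x.1, fun f => xor (x.2 (π.symm f)) (F x.1 (π.symm f)))

section Twist

variable {M : Type} (π : Equiv.Perm M) (F : M → M → Bool)

theorem twist_injective : Function.Injective (twist π F) := by
  rintro ⟨e, χ⟩ ⟨f, ψ⟩ h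
  simp only [twist, Prod.mk.injEq, EmbeddingLike.apply_eq_iff_eq] at h
  obtain ⟨rfl, h⟩ := h
  congr 1
  ext g
  simpa using congrFun h (π g)

theorem twist_bijective [Finite M] : Function.Bijective (twist π F) :=
  Finite.injective_iff_bijective.mp (twist_injective π F)

theorem twist_antipode (x : M × (M → Bool)) :
    twist π F (antipode x) = antipode (twist π F x) := by
  simp [twist, antipode]

variable {F}

theorem parity_twist (hF : ∀ e f, F e f = F f e) (x y : M × (M → Bool)) :
    parity (twist π F x) (twist π F y) = parity x y := by
  simp only [parity, twist, Equiv.symm_apply_apply, hF y.1 x.1]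
  cases x.2 y.1 <;> cases y.2 x.1 <;> cases F x.1 y.1 <;> rfl

theorem valDist_twist (hF : ∀ e f, F e f = F f e) (x y : M × (M → Bool)) :
    valDist (twist π F x) (twist π F y) = valDist x y := by
  have h1 := (twist_injective π F).eq_iff (a := x) (b := y)
  have h2 := (twist_injective π F).eq_iff (a := y) (b := antipode x)
  rw [twist_antipode] at h2
  simp only [valDist, parity_twist π hF]
  grind

end Twist

theorem exists_perm_extending {ι M : Type} [Finite M] (k l : ι → M)
    (h : ∀ i j, k i = k j ↔ l i = l j) : ∃ π : Equiv.Perm M, ∀ i, π (k i) = l i := by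
  classical
  have := Fintype.ofFinite M
  have hk : ∀ e : Set.range k, k e.2.choose = e := fun e => e.2.choose_spec
  let g : Set.range k → Set.range l := fun e => ⟨l e.2.choose, e.2.choose, rfl⟩
  have hg : Function.Bijective g := by
    constructor
    · intro e f hef
      have := (h _ _).mpr (congrArg Subtype.val hef)
      rw [hk, hk] at this
      exact Subtype.ext this
    · rintro ⟨_, i, rfl⟩
      exact ⟨⟨k i, i, rfl⟩, Subtype.ext ((h _ _).mp (hk ⟨k i, i, rfl⟩))⟩
  let g' : {x // x ∈ Set.range k} ≃ {x // x ∈ Set.range l} := Equiv.ofBijective g hg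
  refine ⟨g'.extendSubtype, fun i => ?_⟩
  rw [Equiv.extendSubtype_apply_of_mem g' (k i) ⟨i, rfl⟩]
  exact (h _ _).mp (hk ⟨k i, i, rfl⟩)

theorem exists_symmetric_extending {ι M : Type} (k : ι → M) (G : ι → M → Bool)
    (hG : ∀ i j, G i (k j) = G j (k i)) (hk : ∀ i j, k i = k j → G i = G j) :
    ∃ F : M → M → Bool, (∀ e f, F e f = F f e) ∧ (∀ i f, F (k i) f = G i f) ∧
      ((∀ i, G i (k i) = false) → ∀ e, F e e = false) := by
  classical
  refine ⟨fun e f => if he : ∃ i, k i = e then G he.choose f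
    else if hf : ∃ i, k i = f then G hf.choose e else false, ?_, ?_, ?_⟩
  · intro e f
    by_cases he : ∃ i, k i = e <;> by_cases hf : ∃ i, k i = f <;>
      simp only [he, hf, dite_true, dite_false]
    have := hG he.choose hf.choose
    rwa [he.choose_spec, hf.choose_spec] at this
  · intro i f
    have he : ∃ j, k j = k i := ⟨i, rfl⟩
    simp only [he, dite_true]
    rw [hk _ _ he.choose_spec]
  · intro h e
    by_cases he : ∃ i, k i = e <;> simp only [he, dite_true, dite_false]
    have := h he.choose
    rwa [he.choose_spec] at this

theorem exists_splitting {M : Type} (D : M → M → Bool) (hD : ∀ e f, D e f = D f e)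
    (h0 : ∀ e, D e e = false) :
    ∃ v : M → M → Bool, (∀ e, v e e = false) ∧ ∀ e f, xor (v e f) (v f e) = D e f := by
  classical
  refine ⟨fun e f => if WellOrderingRel e f then D e f else false, fun e => by simp [h0], ?_⟩
  intro e f
  rcases trichotomous_of WellOrderingRel e f with h | rfl | h
  · simp [h, asymm_of WellOrderingRel h]
  · simp [h0]
  · simp [h, asymm_of WellOrderingRel h, hD e f]

section Space

variable {A : Type} {d : A → A → ℕ}

theorem isAntipodalSpace_flip (hA : IsAntipodalSpace d) {x x' : A} (h : d x x' = 3) (y : A) :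
    decide (2 ≤ d x' y) = !decide (2 ≤ d x y) := by
  obtain ⟨h0, hs, ht, hv, h223, hu⟩ := hA
  have h' := (hs x' x).trans h
  have e1 := (hu x).unique h (y₂ := y)
  have e2 := (hu x').unique h' (y₂ := y)
  have t1 := ht x y x'
  have t2 := h223 x y x'
  have v1 := hv x y
  have v2 := hv x' y
  rw [hs y x'] at t1 t2
  by_cases hx : x = y
  · subst hx
    simp [h0, h']
  by_cases hx' : x' = y
  · subst hx'
    simp [h0, h]
  have n1 : d x y ≠ 3 := fun h => hx' (e1 h)
  have n2 : d x' y ≠ 3 := fun h => hx (e2 h)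
  have v1 := v1 hx
  have v2 := v2 hx'
  by_cases h2 : d x y = 2
  · have : d x' y = 1 := by lia
    simp [h2, this]
  · have h1 : d x y = 1 := by lia
    have : d x' y = 2 := by lia
    simp [h1, this]

theorem exists_coordinates [Finite A] (hA : IsAntipodalSpace d) (p : A → Bool)
    (hp : ∀ x y : A, d x y = 3 → p x ≠ p y) :
    ∃ (M : Type) (_ : Finite M) (r : A → M) (v : M → M → Bool),
      (∀ x y, r x = r y ↔ x = y ∨ d x y = 3) ∧ (∀ e, v e e = false) ∧
      ∀ x y, decide (2 ≤ d x y) =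
        xor (xor (v (r x) (r y)) (v (r y) (r x))) (xor (p x) (p y)) := by
  obtain ⟨h0, hs, -, -, -, hu⟩ := id hA
  have hex : ∀ x : A, ∃ e : {x : A // p x = false},
      (p x = false → (e : A) = x) ∧ (p x = true → d e x = 3) := by
    intro x
    obtain ⟨x', hx', -⟩ := hu x
    have hpx := hp x x' hx'
    cases hx : p x
    · exact ⟨⟨x, hx⟩, by simp⟩
    · exact ⟨⟨x', by simpa [hx] using hpx⟩, by simp, fun _ => (hs x' x).trans hx'⟩
  choose r hr0 hr1 using hex
  have hswap : ∀ a b : A, decide (2 ≤ d a b) = xor (decide (2 ≤ d (r a) b)) (p a) := by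
    intro a b
    cases ha : p a
    · simp [hr0 a ha]
    · simp [isAntipodalSpace_flip hA (hr1 a ha) b]
  obtain ⟨v, hv0, hvD⟩ := exists_splitting
    (fun e f : {x : A // p x = false} => decide (2 ≤ d e f))
    (fun e f => by simp only [hs e f]) (fun e => by simp [h0])
  refine ⟨{x : A // p x = false}, inferInstance, r, v, ?_, hv0, ?_⟩
  · intro x y
    constructor
    · intro h
      cases hx : p x <;> cases hy : p y
      · exact Or.inl (by rw [← hr0 x hx, h, hr0 y hy])
      · exact Or.inr (by rw [← hr0 x hx, h, hr1 y hy])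
      · exact Or.inr (by rw [← hr0 y hy, ← h, hs, hr1 x hx])
      · exact Or.inl ((hu (r y)).unique (h ▸ hr1 x hx) (hr1 y hy))
    · rintro (rfl | h)
      · rfl
      · have hpne := hp x y h
        apply Subtype.ext
        cases hx : p x <;> cases hy : p y
        · exact absurd (hx.trans hy.symm) hpne
        · rw [hr0 x hx]
          exact (hu y).unique ((hs y x).trans h) ((hs _ _).trans (hr1 y hy))
        · rw [hr0 y hy]
          exact (hu x).unique ((hs _ _).trans (hr1 x hx)) h
        · exact absurd (hx.trans hy.symm) hpne
  · intro x y
    rw [hvD, hswap x y, hs (r x) y, hswap y (r x), hs (r y) (r x), Bool.xor_assoc,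
      Bool.xor_comm (p y)]

/-- The vertex of the valuation space with coordinates `r x`, `v (r x)`, flipped if `p x`. -/
def vertex {M : Type} (p : A → Bool) (r : A → M) (v : M → M → Bool) (x : A) :
    M × (M → Bool) :=
  (r x, fun f => xor (v (r x) f) (p x))

section Vertex

variable {M : Type} {p : A → Bool} {r : A → M} {v : M → M → Bool}

theorem parity_vertex (hD : ∀ x y, decide (2 ≤ d x y) =
      xor (xor (v (r x) (r y)) (v (r y) (r x))) (xor (p x) (p y))) (x y : A) :
    parity (vertex p r v x) (vertex p r v y) = decide (2 ≤ d x y) := by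
  rw [hD]
  simp only [vertex, parity]
  generalize v (r x) (r y) = a
  generalize v (r y) (r x) = b
  cases a <;> cases b <;> cases p x <;> cases p y <;> rfl

theorem xor_of_coordinate_eq (hD : ∀ x y, decide (2 ≤ d x y) =
      xor (xor (v (r x) (r y)) (v (r y) (r x))) (xor (p x) (p y))) {x y : A}
    (h : r x = r y) : xor (p x) (p y) = decide (2 ≤ d x y) := by
  rw [hD, h]
  simp

theorem vertex_injective (hr : ∀ x y, r x = r y ↔ x = y ∨ d x y = 3)
    (hD : ∀ x y, decide (2 ≤ d x y) =
      xor (xor (v (r x) (r y)) (v (r y) (r x))) (xor (p x) (p y))) :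
    Function.Injective (vertex p r v) := by
  intro x y h
  have h1 := parity_vertex hD x y
  rw [h, parity_self] at h1
  rcases (hr x y).mp (congrArg Prod.fst h) with h2 | h2
  · exact h2
  · simp [h2] at h1

theorem vertex_eq_antipode_iff (hr : ∀ x y, r x = r y ↔ x = y ∨ d x y = 3)
    (hD : ∀ x y, decide (2 ≤ d x y) =
      xor (xor (v (r x) (r y)) (v (r y) (r x))) (xor (p x) (p y))) (x y : A) :
    vertex p r v y = antipode (vertex p r v x) ↔ d x y = 3 := by
  constructor
  · intro h
    have h1 : r y = r x := congrArg Prod.fst h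
    rcases (hr x y).mp h1.symm with rfl | h2
    · exact absurd h.symm (antipode_ne _)
    · exact h2
  · intro h
    have h1 := (hr x y).mpr (Or.inr h)
    have h2 := xor_of_coordinate_eq hD h1
    simp only [h, Nat.reduceLeDiff, decide_true] at h2
    simp only [vertex, antipode, h1, Prod.mk.injEq, true_and]
    funext f
    revert h2
    cases v (r y) f <;> cases p x <;> cases p y <;> simp

theorem valDist_vertex (hA : IsAntipodalSpace d)
    (hr : ∀ x y, r x = r y ↔ x = y ∨ d x y = 3)
    (hD : ∀ x y, decide (2 ≤ d x y) =
      xor (xor (v (r x) (r y)) (v (r y) (r x))) (xor (p x) (p y))) (x y : A) :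
    valDist (vertex p r v x) (vertex p r v y) = d x y := by
  have h1 := (vertex_injective hr hD).eq_iff (a := x) (b := y)
  have h2 := vertex_eq_antipode_iff hr hD x y
  have h3 := parity_vertex hD x y
  have hv := hA.2.2.2.1 x y
  have h0 := hA.1 x
  unfold valDist
  grind

theorem exists_isometry_extending [Finite M] (hr : ∀ x y, r x = r y ↔ x = y ∨ d x y = 3)
    (hv0 : ∀ e, v e e = false)
    (hD : ∀ x y, decide (2 ≤ d x y) =
      xor (xor (v (r x) (r y)) (v (r y) (r x))) (xor (p x) (p y)))
    {q : Set (A × A)} (hq : IsPartialIsometry d q) :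
    ∃ θ : M × (M → Bool) → M × (M → Bool), Function.Bijective θ ∧
      (∀ x y, valDist (θ x) (θ y) = valDist x y) ∧
      (∀ u ∈ q, θ (vertex p r v u.1) = vertex p r v u.2) ∧
      ((∀ u ∈ q, p u.2 = p u.1) → ∀ y, (θ y).2 (θ y).1 = y.2 y.1) := by
  obtain ⟨hq, hqd⟩ := hq
  have hkl : ∀ u w : q, r u.1.1 = r w.1.1 ↔ r u.1.2 = r w.1.2 := by
    intro u w
    rw [hr, hr, hq _ u.2 _ w.2, hqd _ u.2 _ w.2]
  obtain ⟨π, hπ⟩ := exists_perm_extending (fun u : q => r u.1.1) (fun u => r u.1.2) hkl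
  obtain ⟨F, hFs, hFG, hF0⟩ := exists_symmetric_extending (fun u : q => r u.1.1)
    (fun u f => xor ((vertex p r v u.1.2).2 (π f)) ((vertex p r v u.1.1).2 f))
    (by
      intro u w
      have h1 := parity_vertex hD u.1.1 w.1.1
      have h2 := parity_vertex hD u.1.2 w.1.2
      rw [← hqd _ u.2 _ w.2, ← h1] at h2
      simp only [hπ]
      change xor ((vertex p r v u.1.2).2 (r w.1.2)) ((vertex p r v w.1.2).2 (r u.1.2)) =
        xor ((vertex p r v u.1.1).2 (r w.1.1)) ((vertex p r v w.1.1).2 (r u.1.1)) at h2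
      revert h2
      generalize (vertex p r v u.1.2).2 (r w.1.2) = a
      generalize (vertex p r v w.1.2).2 (r u.1.2) = b
      generalize (vertex p r v u.1.1).2 (r w.1.1) = a'
      generalize (vertex p r v w.1.1).2 (r u.1.1) = b'
      revert a b a' b'
      decide)
    (by
      intro u w h
      have h' := (hkl u w).mp h
      have h1 := xor_of_coordinate_eq hD h
      have h2 := xor_of_coordinate_eq hD h'
      rw [← hqd _ u.2 _ w.2, ← h1] at h2
      funext f
      change r u.1.1 = r w.1.1 at h
      simp only [vertex, h, h']
      revert h2
      generalize v (r w.1.2) (π f) = a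
      generalize v (r w.1.1) f = b
      generalize p u.1.1 = c
      generalize p u.1.2 = c'
      generalize p w.1.1 = e
      generalize p w.1.2 = e'
      revert a b c c' e e'
      decide)
  refine ⟨twist π F, twist_bijective π F, valDist_twist π hFs, ?_, ?_⟩
  · intro u hu
    refine Prod.ext (hπ ⟨u, hu⟩) ?_
    funext f
    have h := hFG ⟨u, hu⟩ (π.symm f)
    simp only [Equiv.apply_symm_apply] at h
    change xor ((vertex p r v u.1).2 (π.symm f)) (F (r u.1) (π.symm f)) =
      (vertex p r v u.2).2 f
    rw [h, Bool.xor_comm, Bool.xor_assoc, Bool.xor_self, Bool.xor_false]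
  · intro hpq y
    have h := hF0 (by
      intro u
      simp only [hπ]
      simp [vertex, hv0, hpq _ u.2]) y.1
    simp [twist, h]

end Vertex

end Space

end AntipodalEPPA

open AntipodalEPPA in
/-- EPPA for finite integer-valued antipodal metric spaces of diameter 3,
respecting a partition of `A` into podes: given `p : A → Bool` taking distinct
values on antipodal points, there are an extension `B` of `A` and an extension
`p̂ : B → Bool` of `p` such that every partial isometry `φ` of `A` extends to
a surjective self-isometry `θ` of `B` which, in case `φ` preserves the values
of `p`, moreover preserves the values of `p̂`. -/
theorem antipodal_EPPA_with_podes (A : Type) [Fintype A] (dA : A → A → ℕ)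
    (hA : IsAntipodalSpace dA) (p : A → Bool)
    (hp : ∀ x y : A, dA x y = 3 → p x ≠ p y) :
    ∃ (B : Type) (_ : Fintype B) (dB : B → B → ℕ) (i : A ↪ B) (phat : B → Bool),
      IsAntipodalSpace dB ∧
      (∀ x y : A, dB (i x) (i y) = dA x y) ∧
      (∀ x : A, phat (i x) = p x) ∧
      (∀ q : Set (A × A), IsPartialIsometry dA q →
        ∃ θ : B → B, Function.Bijective θ ∧
          (∀ x y : B, dB (θ x) (θ y) = dB x y) ∧
          (∀ u ∈ q, θ (i u.1) = i u.2) ∧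
          ((∀ u ∈ q, p u.2 = p u.1) → ∀ y : B, phat (θ y) = phat y)) := by
  obtain ⟨M, hM, r, v, hr, hv0, hD⟩ := exists_coordinates hA p hp
  exact ⟨M × (M → Bool), Fintype.ofFinite _, valDist, ⟨vertex p r v, vertex_injective hr hD⟩,
    fun y => y.2 y.1, isAntipodalSpace_valDist, valDist_vertex hA hr hD,
    fun x => by simp [vertex, hv0], fun _ hq => exists_isometry_extending hr hv0 hD hq⟩
end

section
/- For every finite graph G, the structure A(G) is a finite antipodal integer-valued metric space of diameter 3: the function d is a metric on G×{0,1}, the distance between any two distinct points lies in {1,2,3}, no three points have pairwise distances 2,2,3, and every point (x,i) has exactly one point at distance 3, namely (x,1−i). -/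
/-- The distance function of the space `A(G)` on `V × Bool`, for a graph `G`:
`d((x,i),(x,1-i)) = 3`; for `x ≠ y`, `d((x,i),(y,j)) = 1` when either `{x,y}`
is an edge and `i = j`, or `{x,y}` is a non-edge and `i ≠ j`; and
`d((x,i),(y,j)) = 2` otherwise. -/
def dAG {V : Type} [DecidableEq V] (G : SimpleGraph V) [DecidableRel G.Adj] :
    (V × Bool) → (V × Bool) → ℕ := fun u v =>
  if u = v then 0
  else if u.1 = v.1 then 3
  else if (G.Adj u.1 v.1 ∧ u.2 = v.2) ∨ (¬G.Adj u.1 v.1 ∧ u.2 ≠ v.2) then 1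
  else 2

section

variable {V : Type} [DecidableEq V] (G : SimpleGraph V) [DecidableRel G.Adj]

theorem dAG_comm (u v : V × Bool) : dAG G u v = dAG G v u := by
  simp only [dAG, eq_comm (a := u), eq_comm (a := u.1), eq_comm (a := u.2), G.adj_comm u.1, ne_eq]

theorem dAG_eq_three_iff (u v : V × Bool) : dAG G u v = 3 ↔ v = (u.1, !u.2) := by
  obtain ⟨x, i⟩ := u
  obtain ⟨y, j⟩ := v
  simp only [dAG, Prod.mk.injEq]
  cases i <;> cases j <;> grind

theorem dAG_antipode_add (u v : V × Bool) : dAG G (u.1, !u.2) v + dAG G u v = 3 := by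
  obtain ⟨x, i⟩ := u
  obtain ⟨y, j⟩ := v
  simp only [dAG, Prod.mk.injEq]
  cases i <;> cases j <;> grind

theorem dAG_eq_zero_iff (u v : V × Bool) : dAG G u v = 0 ↔ u = v := by
  grind [dAG]

theorem dAG_le_three (u v : V × Bool) : dAG G u v ≤ 3 := by
  grind [dAG]

theorem dAG_triangle (u v w : V × Bool) : dAG G u w ≤ dAG G u v + dAG G v w := by
  by_cases huv : u = v
  · subst huv
    exact Nat.le_add_left _ _
  by_cases hvw : v = w
  · subst hvw
    exact Nat.le_add_right _ _
  have hu := mt (dAG_eq_zero_iff G u v).1 huv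
  have hv := mt (dAG_eq_zero_iff G v w).1 hvw
  by_cases huw : dAG G u w = 3
  · obtain rfl := (dAG_eq_three_iff G u w).1 huw
    have := dAG_antipode_add G u v
    have := dAG_comm G v (u.1, !u.2)
    omega
  · have := dAG_le_three G u w
    omega

end

/-- For every finite graph `G`, the structure `A(G)` is a finite antipodal
integer-valued metric space of diameter 3, in which the unique point at
distance 3 from `(x, i)` is `(x, 1-i)`. -/
theorem AG_is_antipodal (V : Type) [Fintype V] [DecidableEq V]
    (G : SimpleGraph V) [DecidableRel G.Adj] :
    IsAntipodalSpace (dAG G) ∧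
    ∀ u : V × Bool,
      dAG G u (u.1, !u.2) = 3 ∧
      ∀ v : V × Bool, dAG G u v = 3 → v = (u.1, !u.2) := by
  refine ⟨⟨fun u => (dAG_eq_zero_iff G u u).2 rfl, dAG_comm G, dAG_triangle G, ?_, ?_, ?_⟩,
    fun u => ⟨(dAG_eq_three_iff G u _).2 rfl, fun v => (dAG_eq_three_iff G u v).1⟩⟩
  · intro u v huv
    have := mt (dAG_eq_zero_iff G u v).1 huv
    have := dAG_le_three G u v
    omega
  · rintro u v w ⟨huv, hvw, huw⟩
    obtain rfl := (dAG_eq_three_iff G u w).1 huw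
    have := dAG_antipode_add G u v
    have := dAG_comm G v (u.1, !u.2)
    omega
  · exact fun u => ⟨(u.1, !u.2), (dAG_eq_three_iff G u _).2 rfl,
      fun v => (dAG_eq_three_iff G u v).1⟩
end

section
/- For every finite antipodal integer-valued metric space A of diameter 3, the associated hypergraph T(A) is a two-graph on M(A): every 4-element subset of M(A) contains an even number of hyperedges of T(A). -/
/-- `s` is an unordered pair of points of `(A, d)` at distance 3, i.e. an
element of `M(A)`. -/
def IsPair3 {A : Type} (d : A → A → ℕ) (s : Finset A) : Prop :=
  s.card = 2 ∧ ∀ x ∈ s, ∀ y ∈ s, x ≠ y → d x y = 3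

/-- Three pairs `a, b, c ∈ M(A)` form a hyperedge of the associated hypergraph
`T(A)`: they carry three points that are pairwise at distance 1. -/
def THyper {A : Type} (d : A → A → ℕ) (a b c : Finset A) : Prop :=
  ∃ x ∈ a, ∃ y ∈ b, ∃ z ∈ c, d x y = 1 ∧ d y z = 1 ∧ d x z = 1

namespace IsAntipodalSpace

variable {A : Type} {d : A → A → ℕ}

theorem mem_pair_iff (hA : IsAntipodalSpace d) {a : Finset A} (ha : IsPair3 d a) {x : A}
    (hx : x ∈ a) (z : A) : z ∈ a ↔ z = x ∨ d x z = 3 := by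
  obtain ⟨-, -, -, -, -, huniq⟩ := hA
  refine ⟨fun hz => ?_, ?_⟩
  · by_cases h : z = x
    · exact Or.inl h
    · exact Or.inr (ha.2 x hx z hz (Ne.symm h))
  · rintro (rfl | h)
    · exact hx
    · obtain ⟨w, hw, hwx⟩ := Finset.exists_mem_ne (by rw [ha.1]; norm_num) x
      rwa [(huniq x).unique h (ha.2 x hx w hw hwx.symm)]

theorem pair_eq_of_mem (hA : IsAntipodalSpace d) {a b : Finset A} (ha : IsPair3 d a)
    (hb : IsPair3 d b) {x : A} (hxa : x ∈ a) (hxb : x ∈ b) : a = b := by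
  ext z
  rw [hA.mem_pair_iff ha hxa, hA.mem_pair_iff hb hxb]

theorem dist_antipode_eq_one_iff (hA : IsAntipodalSpace d) {x x' y : A} (h : d x x' = 3)
    (hyx : y ≠ x) (hyx' : y ≠ x') : d x' y = 1 ↔ ¬ d x y = 1 := by
  obtain ⟨-, hsymm, htri, hval, h223, huniq⟩ := hA
  have hne : d x y ≠ 3 := fun h' => hyx' ((huniq x).unique h' h)
  have hne' : d x' y ≠ 3 := fun h' => hyx ((huniq x').unique h' (by rw [hsymm, h]))
  have ht := htri x y x'
  have hn := h223 x y x'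
  have h1 := hval x y hyx.symm
  have h2 := hval x' y hyx'.symm
  rw [hsymm y x'] at ht hn
  omega

theorem dist_eq_one_iff_of_pairs (hA : IsAntipodalSpace d) {a b : Finset A} (ha : IsPair3 d a)
    (hb : IsPair3 d b) (hab : a ≠ b) {x x' y : A} (hx : x ∈ a) (hx' : x' ∈ a)
    (h : d x x' = 3) (hy : y ∈ b) : d x' y = 1 ↔ ¬ d x y = 1 := by
  refine hA.dist_antipode_eq_one_iff h ?_ ?_
  · rintro rfl
    exact hab (hA.pair_eq_of_mem ha hb hx hy)
  · rintro rfl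
    exact hab (hA.pair_eq_of_mem ha hb hx' hy)

theorem tHyper_iff (hA : IsAntipodalSpace d) {a b c : Finset A} (ha : IsPair3 d a)
    (hb : IsPair3 d b) (hc : IsPair3 d c) (hab : a ≠ b) (hac : a ≠ c) (hbc : b ≠ c)
    {x y z : A} (hx : x ∈ a) (hy : y ∈ b) (hz : z ∈ c) :
    THyper d a b c ↔ ((d x y = 1 ↔ d y z = 1) ↔ d x z = 1) := by
  have hsymm := hA.2.1
  obtain ⟨x', hxx', -⟩ := hA.2.2.2.2.2 x
  obtain ⟨y', hyy', -⟩ := hA.2.2.2.2.2 y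
  obtain ⟨z', hzz', -⟩ := hA.2.2.2.2.2 z
  have hx' : x' ∈ a := (hA.mem_pair_iff ha hx x').2 (Or.inr hxx')
  have hy' : y' ∈ b := (hA.mem_pair_iff hb hy y').2 (Or.inr hyy')
  have hz' : z' ∈ c := (hA.mem_pair_iff hc hz z').2 (Or.inr hzz')
  have ma : ∀ w ∈ a, w = x ∨ w = x' := fun w hw =>
    ((hA.mem_pair_iff ha hx w).1 hw).imp_right fun h => (hA.2.2.2.2.2 x).unique h hxx'
  have mb : ∀ w ∈ b, w = y ∨ w = y' := fun w hw =>
    ((hA.mem_pair_iff hb hy w).1 hw).imp_right fun h => (hA.2.2.2.2.2 y).unique h hyy'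
  have mc : ∀ w ∈ c, w = z ∨ w = z' := fun w hw =>
    ((hA.mem_pair_iff hc hz w).1 hw).imp_right fun h => (hA.2.2.2.2.2 z).unique h hzz'
  have xy : ∀ w ∈ b, (d x' w = 1 ↔ ¬ d x w = 1) := fun w hw =>
    hA.dist_eq_one_iff_of_pairs ha hb hab hx hx' hxx' hw
  have xz : ∀ w ∈ c, (d x' w = 1 ↔ ¬ d x w = 1) := fun w hw =>
    hA.dist_eq_one_iff_of_pairs ha hc hac hx hx' hxx' hw
  have yz : ∀ w ∈ c, (d y' w = 1 ↔ ¬ d y w = 1) := fun w hw =>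
    hA.dist_eq_one_iff_of_pairs hb hc hbc hy hy' hyy' hw
  have yx : d x y' = 1 ↔ ¬ d x y = 1 := by
    rw [hsymm x, hsymm x]
    exact hA.dist_eq_one_iff_of_pairs hb ha hab.symm hy hy' hyy' hx
  have zx : d x z' = 1 ↔ ¬ d x z = 1 := by
    rw [hsymm x, hsymm x]
    exact hA.dist_eq_one_iff_of_pairs hc ha hac.symm hz hz' hzz' hx
  have zy : d y z' = 1 ↔ ¬ d y z = 1 := by
    rw [hsymm y, hsymm y]
    exact hA.dist_eq_one_iff_of_pairs hc hb hbc.symm hz hz' hzz' hy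
  constructor
  · rintro ⟨u, hu, v, hv, w, hw, h1, h2, h3⟩
    rcases ma u hu with rfl | rfl <;> rcases mb v hv with rfl | rfl <;>
      rcases mc w hw with rfl | rfl <;>
      (try simp only [xy _ hy, xy _ hy', xz _ hz, xz _ hz', yz _ hz, yz _ hz', yx, zx, zy]
        at h1 h2 h3) <;>
      tauto
  · intro h
    by_cases p : d x y = 1 <;> by_cases q : d y z = 1
    · exact ⟨x, hx, y, hy, z, hz, p, q, by tauto⟩
    · exact ⟨x, hx, y, hy, z', hz', p, by tauto, by tauto⟩
    · exact ⟨x', hx', y, hy, z, hz, (xy y hy).2 p, q, (xz z hz).2 (by tauto)⟩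
    · exact ⟨x, hx, y', hy', z, hz, yx.2 p, (yz z hz).2 q, by tauto⟩

end IsAntipodalSpace

/-- For every finite antipodal integer-valued metric space `A` of diameter 3,
the associated hypergraph `T(A)` is a two-graph on `M(A)`: every four distinct
elements of `M(A)` contain an even number of hyperedges of `T(A)`. -/
theorem TA_is_twograph (A : Type) [Fintype A] (dA : A → A → ℕ)
    (hA : IsAntipodalSpace dA) (a b c d : Finset A)
    (ha : IsPair3 dA a) (hb : IsPair3 dA b) (hc : IsPair3 dA c)
    (hd : IsPair3 dA d)
    (hab : a ≠ b) (hac : a ≠ c) (had : a ≠ d)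
    (hbc : b ≠ c) (hbd : b ≠ d) (hcd : c ≠ d) :
    Even (indic (THyper dA a b c) + indic (THyper dA a b d) +
      indic (THyper dA a c d) + indic (THyper dA b c d)) := by
  have hne : ∀ {s : Finset A}, IsPair3 dA s → s.Nonempty := fun hs =>
    Finset.card_pos.mp (by rw [hs.1]; norm_num)
  obtain ⟨x, hx⟩ := hne ha
  obtain ⟨y, hy⟩ := hne hb
  obtain ⟨z, hz⟩ := hne hc
  obtain ⟨w, hw⟩ := hne hd
  rw [hA.tHyper_iff ha hb hc hab hac hbc hx hy hz, hA.tHyper_iff ha hb hd hab had hbd hx hy hw,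
    hA.tHyper_iff ha hc hd hac had hcd hx hz hw, hA.tHyper_iff hb hc hd hbc hbd hcd hy hz hw]
  unfold indic
  by_cases h1 : dA x y = 1 <;> by_cases h2 : dA x z = 1 <;> by_cases h3 : dA x w = 1 <;>
    by_cases h4 : dA y z = 1 <;> by_cases h5 : dA y w = 1 <;> by_cases h6 : dA z w = 1 <;>
    simp [h1, h2, h3, h4, h5, h6] <;> decide
end

section
/- Let A be an antipodal integer-valued metric space of diameter 3 and let a, b, c, d be four distinct points of A with d(a,b) = d(c,d) = 3. Then d(a,c) = d(b,d), d(a,d) = d(b,c), and {d(a,c), d(a,d)} = {1,2}. -/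
/-- In an antipodal integer-valued metric space of diameter 3, four distinct
points `a, b, c, e` with `d(a,b) = d(c,e) = 3` form an antipodal quadruple:
`d(a,c) = d(b,e)`, `d(a,e) = d(b,c)`, and the two distances `d(a,c)`, `d(a,e)`
are `1` and `2` in some order. -/
theorem antipodal_quadruple {A : Type} (d : A → A → ℕ)
    (hA : IsAntipodalSpace d) (a b c e : A)
    (hab' : a ≠ b) (hac : a ≠ c) (hae : a ≠ e)
    (hbc : b ≠ c) (hbe : b ≠ e) (hce : c ≠ e)
    (hab : d a b = 3) (hce' : d c e = 3) :
    d a c = d b e ∧ d a e = d b c ∧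
      ((d a c = 1 ∧ d a e = 2) ∨ (d a c = 2 ∧ d a e = 1)) := by
  obtain ⟨-, symm, tri, vals, no223, uniq⟩ := hA
  have sum_eq_three : ∀ x y z : A, x ≠ y → x ≠ z → y ≠ z → d x z = 3 →
      d x y + d y z = 3 ∧ d x y ≠ 3 := by
    intro x y z hxy hxz hyz h
    have hxy3 : d x y ≠ 3 := fun h' => hyz ((uniq x).unique h' h)
    have hyz3 : d y z ≠ 3 := fun h' =>
      hxy ((uniq z).unique ((symm z x).trans h) ((symm z y).trans h'))
    have := tri x y z
    have := no223 x y z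
    have := vals x y hxy
    have := vals y z hyz
    omega
  have h₁ := sum_eq_three a c b hac hab' hbc.symm hab
  have h₂ := sum_eq_three a e b hae hab' hbe.symm hab
  have h₃ := sum_eq_three c a e hac.symm hce hae hce'
  have h₄ := vals a c hac
  have := symm c a
  have := symm c b
  have := symm e b
  omega
end

section
/- For every finite two-graph A there exists a finite two-graph B such that for every finite graph G whose associated two-graph T(G) is isomorphic to A and every finite graph H whose associated two-graph T(H) is isomorphic to B, the graph G is isomorphic to an induced subgraph of H. (In other words, every graph in the switching class of B contains an induced copy of every graph in the switching class of A.) -/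
/-- The triple `{x, y, z}` is a hyperedge of the two-graph `T(G)` associated to
the graph `G`: it induces an odd number of edges of `G`. -/
noncomputable def triOdd {V : Type} (G : SimpleGraph V) (x y z : V) : Prop :=
  Odd (indic (G.Adj x y) + indic (G.Adj x z) + indic (G.Adj y z))

lemma odd_indic_add {P Q R : Prop} :
    Odd (indic P + indic Q + indic R) ↔ ((P ↔ Q) ↔ R) := by
  unfold indic
  by_cases hP : P <;> by_cases hQ : Q <;> by_cases hR : R <;> simp +decide [hP, hQ, hR]

lemma triOdd_iff {V : Type} (G : SimpleGraph V) (x y z : V) :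
    triOdd G x y z ↔ ((G.Adj x y ↔ G.Adj x z) ↔ G.Adj y z) :=
  odd_indic_add

lemma triOdd_of_tri_eq {V : Type} {G : SimpleGraph V} {x y z a b c : V}
    (hxy : x ≠ y) (hxz : x ≠ z) (hyz : y ≠ z) (h : tri x y z = tri a b c)
    (ht : triOdd G a b c) : triOdd G x y z := by
  classical
  have hmem (v : V) : (v = x ∨ v = y ∨ v = z) ↔ (v = a ∨ v = b ∨ v = c) := by
    simpa [tri] using Finset.ext_iff.mp h v
  rw [triOdd_iff] at ht ⊢
  have hab := G.adj_comm a b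
  have hac := G.adj_comm a c
  have hbc := G.adj_comm b c
  rcases (hmem x).mp (by simp) with rfl | rfl | rfl <;>
  rcases (hmem y).mp (by simp) with rfl | rfl | rfl <;>
  rcases (hmem z).mp (by simp) with rfl | rfl | rfl <;>
  first
  | exact absurd rfl hxy
  | exact absurd rfl hxz
  | exact absurd rfl hyz
  | tauto

open scoped Classical in
/-- The two-graph `T(G)` associated to a finite graph `G`. -/
noncomputable def SimpleGraph.twoGraph {V : Type} [Fintype V] (G : SimpleGraph V) :
    Finset (Finset V) :=
  {t | ∃ x y z, x ≠ y ∧ x ≠ z ∧ y ≠ z ∧ t = tri x y z ∧ triOdd G x y z}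

lemma SimpleGraph.tri_mem_twoGraph {V : Type} [Fintype V] (G : SimpleGraph V) {x y z : V}
    (hxy : x ≠ y) (hxz : x ≠ z) (hyz : y ≠ z) :
    tri x y z ∈ G.twoGraph ↔ triOdd G x y z := by
  simp only [twoGraph, Finset.mem_filter, Finset.mem_univ, true_and]
  constructor
  · rintro ⟨a, b, c, -, -, -, h, ht⟩
    exact triOdd_of_tri_eq hxy hxz hyz h ht
  · exact fun ht => ⟨x, y, z, hxy, hxz, hyz, rfl, ht⟩

lemma SimpleGraph.isTwoGraph_twoGraph {V : Type} [Fintype V] (G : SimpleGraph V) :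
    IsTwoGraph G.twoGraph := by
  classical
  refine ⟨fun t ht => ?_, fun a b c d hab hac had hbc hbd hcd => ?_⟩
  · simp only [twoGraph, Finset.mem_filter, Finset.mem_univ, true_and] at ht
    obtain ⟨x, y, z, hxy, hxz, hyz, rfl, -⟩ := ht
    exact Finset.card_eq_three.mpr ⟨x, y, z, hxy, hxz, hyz, by simp [tri]⟩
  · rw [G.tri_mem_twoGraph hab hac hbc, G.tri_mem_twoGraph hab had hbd,
      G.tri_mem_twoGraph hac had hcd, G.tri_mem_twoGraph hbc hbd hcd]
    simp only [triOdd_iff]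
    by_cases h1 : G.Adj a b <;> by_cases h2 : G.Adj a c <;> by_cases h3 : G.Adj a d <;>
    by_cases h4 : G.Adj b c <;> by_cases h5 : G.Adj b d <;> by_cases h6 : G.Adj c d <;>
    simp [indic, h1, h2, h3, h4, h5, h6] <;> decide

/-- Two graphs with the same associated two-graph differ by switching: the vertices can be
two-coloured so that the graphs agree on each colour class. -/
lemma exists_switching {V : Type} (G H : SimpleGraph V)
    (h : ∀ x y z, x ≠ y → x ≠ z → y ≠ z → (triOdd G x y z ↔ triOdd H x y z)) :
    ∃ s : V → Prop, ∀ x y, (s x ↔ s y) → (G.Adj x y ↔ H.Adj x y) := by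
  rcases isEmpty_or_nonempty V with hV | ⟨⟨r⟩⟩
  · exact ⟨fun _ => True, fun x => hV.elim x⟩
  refine ⟨fun x => (G.Adj r x ↔ H.Adj r x), fun x y hs => ?_⟩
  by_cases hxy : x = y
  · simp [hxy]
  by_cases hx : r = x
  · subst hx
    simpa using hs
  by_cases hy : r = y
  · subst hy
    simpa [SimpleGraph.adj_comm _ x r] using hs
  have := h r x y hx hy hxy
  simp only [triOdd_iff] at this
  tauto

/-- The lexicographic product of a graph with itself. -/
def SimpleGraph.lexSquare {V : Type} (F : SimpleGraph V) : SimpleGraph (V × V) where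
  Adj p q := F.Adj p.1 q.1 ∨ p.1 = q.1 ∧ F.Adj p.2 q.2
  symm := ⟨fun _ _ h => h.imp (·.symm) fun h => ⟨h.1.symm, h.2.symm⟩⟩
  loopless := ⟨fun _ h => by simp at h⟩

/-- Every two-colouring of the vertices of `F.lexSquare` has a monochromatic induced copy
of `F`. -/
lemma SimpleGraph.exists_monochromatic_embedding {V : Type} (F : SimpleGraph V)
    (s : V × V → Prop) :
    ∃ f : F ↪g F.lexSquare, ∀ u v, s (f u) ↔ s (f v) := by
  by_cases h : ∃ u, ∀ v, s (u, v)
  · obtain ⟨u, hu⟩ := h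
    exact ⟨⟨⟨fun v => (u, v), fun v w hvw => (Prod.ext_iff.mp hvw).2⟩, fun {v w} =>
      show F.Adj u u ∨ u = u ∧ F.Adj v w ↔ F.Adj v w by simp⟩,
      fun v w => iff_of_true (hu v) (hu w)⟩
  · push Not at h
    choose g hg using h
    refine ⟨⟨⟨fun u => (u, g u), fun u v huv => (Prod.ext_iff.mp huv).1⟩, fun {u v} => ?_⟩,
      fun u v => iff_of_false (hg u) (hg v)⟩
    change F.Adj u v ∨ u = v ∧ F.Adj (g u) (g v) ↔ F.Adj u v
    refine or_iff_left_of_imp ?_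
    rintro ⟨rfl, h⟩
    exact (F.irrefl h).elim

/-- The disjoint union of all graphs on the vertex set `V`. -/
def SimpleGraph.universalSum (V : Type) : SimpleGraph (SimpleGraph V × V) where
  Adj p q := p.1 = q.1 ∧ p.1.Adj p.2 q.2
  symm := ⟨fun _ _ h => ⟨h.1.symm, h.1 ▸ h.2.symm⟩⟩
  loopless := ⟨fun _ h => by simp at h⟩

/-- Expansion property for switching classes: for every finite two-graph `A`
there is a finite two-graph `B` such that every finite graph `G` whose
associated two-graph is isomorphic to `A` embeds as an induced subgraph into
every finite graph `H` whose associated two-graph is isomorphic to `B`. -/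
theorem switching_class_expansion (VA : Type) [Fintype VA]
    (TA : Finset (Finset VA)) (hA : IsTwoGraph TA) :
    ∃ (VB : Type) (_ : Fintype VB) (TB : Finset (Finset VB)),
      IsTwoGraph TB ∧
      ∀ (V1 : Type) (_ : Fintype V1) (G : SimpleGraph V1) (e1 : V1 ≃ VA),
        (∀ x y z : V1, x ≠ y → x ≠ z → y ≠ z →
          (triOdd G x y z ↔ tri (e1 x) (e1 y) (e1 z) ∈ TA)) →
        ∀ (V2 : Type) (_ : Fintype V2) (H : SimpleGraph V2) (e2 : V2 ≃ VB),
          (∀ x y z : V2, x ≠ y → x ≠ z → y ≠ z →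
            (triOdd H x y z ↔ tri (e2 x) (e2 y) (e2 z) ∈ TB)) →
          ∃ f : V1 ↪ V2, ∀ x y : V1, G.Adj x y ↔ H.Adj (f x) (f y) := by
  classical
  refine ⟨_, inferInstance, (SimpleGraph.universalSum VA).lexSquare.twoGraph,
    SimpleGraph.isTwoGraph_twoGraph _, fun V1 _ G e1 _ V2 _ H e2 hH => ?_⟩
  obtain ⟨s, hs⟩ := exists_switching (H.comap e2.symm)
    (SimpleGraph.universalSum VA).lexSquare fun x y z hxy hxz hyz => by
      rw [← SimpleGraph.tri_mem_twoGraph (SimpleGraph.lexSquare _) hxy hxz hyz]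
      simpa [triOdd_iff] using hH (e2.symm x) (e2.symm y) (e2.symm z)
        (by simpa) (by simpa) (by simpa)
  obtain ⟨f, hf⟩ := (SimpleGraph.universalSum VA).exists_monochromatic_embedding s
  refine ⟨⟨fun x => e2.symm (f (G.comap e1.symm, e1 x)), fun x y hxy => ?_⟩, fun x y => ?_⟩
  · simpa using hxy
  · have := hs _ _ (hf (G.comap e1.symm, e1 x) (G.comap e1.symm, e1 y))
    rw [f.map_adj_iff] at this
    simpa [SimpleGraph.universalSum] using this.symm
end

section
/- The class of linearly ordered finite two-graphs is not Ramsey for colouring pairs of vertices: there exist a finite two-graph B and a linear order on its vertex set such that for every finite two-graph C with a linear order on its vertex set there is a colouring of the 2-element subsets of the vertex set of C with 2 colours with the property that for every order-preserving injection e from the vertices of B to the vertices of C that is an isomorphism of B onto an induced sub-two-graph of C, not all 2-element subsets of the image of e receive the same colour. -/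
/-- The two-element set `{a, b}` (as a `Finset`), defined classically. -/
noncomputable def pairF {V : Type} (a b : V) : Finset V :=
  letI := Classical.decEq V
  {a, b}

theorem indic_eq_ite (P : Prop) [Decidable P] : indic P = if P then 1 else 0 := by
  unfold indic
  congr

theorem tri_eq {V : Type} [DecidableEq V] (a b c : V) : tri a b c = {a, b, c} := by
  unfold tri
  congr!

theorem pairF_eq {V : Type} [DecidableEq V] (a b : V) : pairF a b = {a, b} := by
  unfold pairF
  congr!

/-- In a two-graph, the hyperedges are the triples spanning an odd number of edges of the graph
that joins `x` and `y` when `{v, x, y}` is a hyperedge. -/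
theorem IsTwoGraph.tri_mem_iff {V : Type} {T : Finset (Finset V)} (hT : IsTwoGraph T)
    (v : V) {a b c : V} (hab : a ≠ b) (hac : a ≠ c) (hbc : b ≠ c) :
    tri a b c ∈ T ↔ Xor (Xor (tri v a b ∈ T) (tri v a c ∈ T)) (tri v b c ∈ T) := by
  classical
  have hdeg (x y : V) : tri x x y ∉ T ∧ tri x y x ∉ T := by
    have hcard : ({x, y} : Finset V).card ≠ 3 := by
      have := Finset.card_le_two (a := x) (b := y)
      omega
    have hyx : ({x, y, x} : Finset V) = {x, y} := by ext; simp; tauto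
    simp only [tri_eq, hyx, Finset.insert_eq_of_mem (Finset.mem_insert_self x {y})]
    exact ⟨fun h => hcard (hT.1 _ h), fun h => hcard (hT.1 _ h)⟩
  by_cases hva : v = a
  · subst hva
    simp [(hdeg v b).1, (hdeg v c).1, Xor]
  by_cases hvb : v = b
  · subst hvb
    have hswap : tri a v c = tri v a c := by simp only [tri_eq]; exact Finset.insert_comm _ _ _
    simp [(hdeg v a).2, (hdeg v c).1, Xor, hswap]
  by_cases hvc : v = c
  · subst hvc
    have hrot : tri a b v = tri v a b := by simp only [tri_eq]; ext; simp; tauto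
    simp [(hdeg v a).2, (hdeg v b).2, Xor, hrot]
  have h := hT.2 v a b c hva hvb hvc hab hac hbc
  simp only [indic_eq_ite] at h
  by_cases h1 : tri v a b ∈ T <;> by_cases h2 : tri v a c ∈ T <;>
    by_cases h3 : tri v b c ∈ T <;> by_cases h4 : tri a b c ∈ T <;>
    simp [h1, h2, h3, h4, Xor] at h ⊢ <;> revert h <;> decide

set_option synthInstance.maxSize 1024 in
/-- The two hyperedges through `0` and `1` form a two-graph on four vertices. -/
theorem isTwoGraph_fin_four :
    IsTwoGraph ({{0, 1, 2}, {0, 1, 3}} : Finset (Finset (Fin 4))) := by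
  refine ⟨by decide, ?_⟩
  simp only [tri_eq, indic_eq_ite]
  decide

/-- The class of linearly ordered finite two-graphs is not Ramsey for
colouring pairs of vertices: there is a linearly ordered finite two-graph `B`
such that for every linearly ordered finite two-graph `C` some 2-colouring
`χ` of the 2-element subsets of `C` admits no copy of `B` in `C` (an
order-preserving embedding of two-graphs) all of whose pairs get the same
colour. -/
theorem ordered_twographs_not_pair_Ramsey :
    ∃ (VB : Type) (_ : Fintype VB) (TB : Finset (Finset VB))
      (rB : LinearOrder VB),
      IsTwoGraph TB ∧
      ∀ (VC : Type) (_ : Fintype VC) (TC : Finset (Finset VC))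
        (rC : LinearOrder VC),
        IsTwoGraph TC →
        ∃ χ : Finset VC → Bool,
          ∀ e : VB → VC,
            (∀ x y : VB, rB.lt x y → rC.lt (e x) (e y)) →
            (∀ x y z : VB, x ≠ y → x ≠ z → y ≠ z →
              (tri x y z ∈ TB ↔ tri (e x) (e y) (e z) ∈ TC)) →
            ∃ x y x' y' : VB, x ≠ y ∧ x' ≠ y' ∧
              χ (pairF (e x) (e y)) ≠ χ (pairF (e x') (e y')) := by
  classical
  refine ⟨Fin 4, inferInstance, {{0, 1, 2}, {0, 1, 3}}, inferInstance, isTwoGraph_fin_four, ?_⟩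
  intro VC _ TC rC hTC
  rcases isEmpty_or_nonempty VC with hV | ⟨⟨v⟩⟩
  · exact ⟨fun _ => true, fun e => (hV.false (e 0)).elim⟩
  refine ⟨fun s => decide (insert v s ∈ TC), fun e he hiso => ?_⟩
  have hne {x y : Fin 4} (hxy : x < y) : e x ≠ e y := (he x y hxy).ne
  by_contra! hmono
  have hpair (x y : Fin 4) (hxy : x ≠ y) :
      tri v (e x) (e y) ∈ TC ↔ tri v (e 0) (e 1) ∈ TC := by
    simpa only [decide_eq_decide, pairF_eq, tri_eq] using hmono x y 0 1 hxy (by decide)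
  have hconst {x y z : Fin 4} (hxy : x < y) (hyz : y < z) :
      tri (e x) (e y) (e z) ∈ TC ↔ tri v (e 0) (e 1) ∈ TC := by
    have hxz := hxy.trans hyz
    rw [hTC.tri_mem_iff v (hne hxy) (hne hxz) (hne hyz), hpair x y hxy.ne, hpair x z hxz.ne,
      hpair y z hyz.ne]
    simp [Xor]
  have h012 := (hiso 0 1 2 (by decide) (by decide) (by decide)).1 (by rw [tri_eq]; decide)
  have h023 : tri (e 0) (e 2) (e 3) ∈ TC :=
    (hconst (by decide) (by decide)).2 ((hconst (by decide) (by decide)).1 h012)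
  have hmem := (hiso 0 2 3 (by decide) (by decide) (by decide)).2 h023
  rw [tri_eq] at hmem
  revert hmem
  decide
end
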